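/- Every outer local flat folding of a closed circular disk with finitely many creases is an outer global flat folding. -/

import Mathlib

noncomputable section

open Set

/-- The closed half-plane bounded by the line through `p` with direction `d`,
lying on the counterclockwise side of that line. -/
def closedHalfPlane (p d : ℂ) : Set ℂ := {z : ℂ | 0 ≤ ((z - p) * starRingEnd ℂ d).im}

/-- The closed wedge with apex `p` spanned by the directions with angles in `[α, β]`. -/
def wedge (p : ℂ) (α β : ℝ) : Set ℂ :=
  {z : ℂ | ∃ r : ℝ, 0 ≤ r ∧ ∃ t : ℝ, α ≤ t ∧ t ≤ β ∧ z = p + r * Complex.exp (t * Complex.I)}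

/-- Euclidean three-dimensional space. -/
abbrev Space3 := EuclideanSpace ℝ (Fin 3)

/-- Vertical projection from three-dimensional space to the plane. -/
def proj2 (q : Space3) : ℂ := ⟨q 0, q 1⟩


/-- `p` is an *unfolded point* of the folding `φ` of the sheet `K`: `φ` agrees with a Euclidean
isometry on the intersection of `K` with some neighborhood of `p`. -/
def UnfoldedPtOn (K : Set ℂ) (φ : ℂ → ℂ) (p : ℂ) : Prop :=
  ∃ U ∈ nhds p, ∃ f : ℂ ≃ᵢ ℂ, Set.EqOn φ ⇑f (U ∩ K)

/-- `p` is a *crease point* of the folding `φ` of the sheet `K`: near `p`, the sheet is covered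
by the two closed half-planes bounded by a line through `p`, with `φ` agreeing with two
distinct isometries on the two halves. -/
def CreasePtOn (K : Set ℂ) (φ : ℂ → ℂ) (p : ℂ) : Prop :=
  ∃ U ∈ nhds p, ∃ d : ℂ, d ≠ 0 ∧ ∃ f₁ f₂ : ℂ ≃ᵢ ℂ, f₁ ≠ f₂ ∧
    Set.EqOn φ ⇑f₁ (U ∩ K ∩ closedHalfPlane p d) ∧
    Set.EqOn φ ⇑f₂ (U ∩ K ∩ closedHalfPlane p (-d))

/-- `p` is a *vertex point* of the folding `φ` of the sheet `K`: near `p`, the sheet is covered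
by finitely many (at least three) closed wedges with apex `p`, with `φ` agreeing with an
isometry on each wedge and at least three distinct isometries occurring. -/
def VertexPtOn (K : Set ℂ) (φ : ℂ → ℂ) (p : ℂ) : Prop :=
  ∃ U ∈ nhds p, ∃ n : ℕ, 3 ≤ n ∧ ∃ (α β : Fin n → ℝ) (f : Fin n → ℂ ≃ᵢ ℂ),
    (∀ i, α i < β i) ∧ (U ∩ K) ⊆ ⋃ i, wedge p (α i) (β i) ∧
    (∀ i, Set.EqOn φ ⇑(f i) (U ∩ K ∩ wedge p (α i) (β i))) ∧
    3 ≤ (Set.range f).ncard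

/-- An *outer local flat folding* of a compact convex region `K`: every point of `K` is an
unfolded point, a crease point, or a vertex point, and all vertex points lie on the boundary
of `K`. -/
structure IsOuterLocalFlatFolding (K : Set ℂ) (φ : ℂ → ℂ) : Prop where
  compact : IsCompact K
  convex : Convex ℝ K
  interior_nonempty : (interior K).Nonempty
  continuousOn : ContinuousOn φ K
  classify : ∀ p ∈ K, UnfoldedPtOn K φ p ∨ CreasePtOn K φ p ∨ VertexPtOn K φ p
  vertex_boundary : ∀ p ∈ K, VertexPtOn K φ p → p ∈ frontier K

/-- The creases of an outer folding are chords of `K`: `u` and `v` are boundary points, the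
open segment between them passes through the interior of `K`, and consists of crease points. -/
def IsCreaseOf (K : Set ℂ) (φ : ℂ → ℂ) (u v : ℂ) : Prop :=
  u ∈ frontier K ∧ v ∈ frontier K ∧ u ≠ v ∧
  openSegment ℝ u v ⊆ interior K ∧
  ∀ z ∈ openSegment ℝ u v, CreasePtOn K φ z

/-- An *outer global flat folding*: an outer local flat folding that, for every `ε > 0`, is
`ε`-close to the vertical projection of a topological embedding of `K` into space. -/
def IsOuterGlobalFlatFolding (K : Set ℂ) (φ : ℂ → ℂ) : Prop :=
  IsOuterLocalFlatFolding K φ ∧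
  ∀ ε : ℝ, 0 < ε → ∃ ψ : ℂ → Space3,
    Topology.IsEmbedding (fun p : K => ψ ↑p) ∧ ∀ p ∈ K, dist (φ p) (proj2 (ψ p)) ≤ ε

/-- `C` is one of the two regions into which the segment `uv` divides `K`. -/
def SideRegion (K : Set ℂ) (u v : ℂ) (C : Set ℂ) : Prop :=
  C = K ∩ {z : ℂ | 0 ≤ ((z - u) * starRingEnd ℂ (v - u)).im} ∨
  C = K ∩ {z : ℂ | ((z - u) * starRingEnd ℂ (v - u)).im ≤ 0}

/-- Along the boundary curve of `C` from `u` to `v` (the part of the boundary of `K` on `C`'s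
side), distances from `u` are monotonically increasing and distances from `v` are
monotonically decreasing. -/
def MonotoneBoundaryArc (K : Set ℂ) (u v : ℂ) (C : Set ℂ) : Prop :=
  ∃ γ : ℝ → ℂ, ContinuousOn γ (Set.Icc 0 1) ∧ γ 0 = u ∧ γ 1 = v ∧
    γ '' Set.Icc 0 1 = frontier K ∩ C ∧
    MonotoneOn (fun t => dist u (γ t)) (Set.Icc 0 1) ∧
    AntitoneOn (fun t => dist v (γ t)) (Set.Icc 0 1)

/-- Reflection of the plane across the line through `u` and `v`. -/
def lineReflect (u v z : ℂ) : ℂ := u + (v - u) * starRingEnd ℂ ((z - u) / (v - u))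

/-- A crease `uv` of `φ`, splitting off the region `C` of `K` with monotone boundary arc, is
*safe* when the reflection across the line `uv` of the boundary arc of `C` does not cross any
crease of `φ`. -/
def SafeCrease (K : Set ℂ) (φ : ℂ → ℂ) (u v : ℂ) (C : Set ℂ) : Prop :=
  IsCreaseOf K φ u v ∧ SideRegion K u v C ∧ MonotoneBoundaryArc K u v C ∧
  ∀ p ∈ lineReflect u v '' (frontier K ∩ C), p ∉ segment ℝ u v → ¬ CreasePtOn K φ p

/-- The vertices of the graph of an outer folding: boundary points of `K` lying on creases. -/
def OuterVertex (K : Set ℂ) (φ : ℂ → ℂ) : Type := {p : ℂ // ∃ q : ℂ, IsCreaseOf K φ p q}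

/-- The graph of an outer folding: vertices are boundary points of `K` on creases, and edges
join the two endpoints of each crease. -/
def outerGraph (K : Set ℂ) (φ : ℂ → ℂ) : SimpleGraph (OuterVertex K φ) :=
  SimpleGraph.fromRel fun a b => IsCreaseOf K φ a.1 b.1

/-- `K` is a (closed, solid) square in the plane. -/
def IsSquareRegion (K : Set ℂ) : Prop :=
  ∃ c w : ℂ, w ≠ 0 ∧
    K = (fun z : ℂ => c + w * z) '' {z : ℂ | z.re ∈ Set.Icc 0 1 ∧ z.im ∈ Set.Icc 0 1}

/-- Signed distance from `x` to the line with unit normal `n` at signed distance `d` from `0`. -/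
def lineFn (n : ℂ) (d : ℝ) (x : ℂ) : ℝ := n.re * x.re + n.im * x.im - d

/-- A cap of the unit disk cannot reach, by moving its points closer to both endpoints of its
chord, a point separated from it by the tangent at one endpoint to the reflected circle. -/
lemma cap_contraction_coord {a b α β d h : ℝ} (hd : 0 ≤ d) (hh : 0 < h) (hdh : d ^ 2 + h ^ 2 = 1)
    (hα : d ≤ α) (hp : α ^ 2 + β ^ 2 ≤ 1) (ha : a ≤ d)
    (h1 : (a - d) ^ 2 + (b - h) ^ 2 ≤ (α - d) ^ 2 + (β - h) ^ 2)
    (h2 : (a - d) ^ 2 + (b + h) ^ 2 ≤ (α - d) ^ 2 + (β + h) ^ 2)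
    (h3 : d * a + h * b ≤ d ^ 2 - h ^ 2) : a = α ∧ b = β := by
  have hβ : |β| ≤ h := abs_le_of_sq_le_sq (by nlinarith) hh.le
  obtain ⟨hβ1, hβ2⟩ := abs_le.1 hβ
  have key : 2 * d - a ≤ α := by
    by_contra hlt
    push Not at hlt
    have hsq : (α - d) ^ 2 < (a - d) ^ 2 := by nlinarith
    have e1 := abs_lt_of_sq_lt_sq (a := b - h) (b := h - β) (by linarith) (by linarith)
    have e2 := abs_lt_of_sq_lt_sq (a := b + h) (b := β + h) (by linarith) (by linarith)
    linarith [(abs_lt.1 e1).1, (abs_lt.1 e2).2]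
  have hprod : 0 ≤ d * (α - (2 * d - a)) := mul_nonneg hd (by linarith)
  have hrefl : (2 * d - a) ^ 2 + b ^ 2 ≤ 1 := by linarith
  have hz : (a - d) ^ 2 + (b + h) ^ 2 ≤ 0 := by linarith
  have ea : a = d := by
    have : (a - d) ^ 2 = 0 := le_antisymm (by linarith [sq_nonneg (b + h)]) (sq_nonneg _)
    linarith [pow_eq_zero_iff two_ne_zero |>.1 this]
  have eb : b = -h := by
    have : (b + h) ^ 2 = 0 := le_antisymm (by linarith [sq_nonneg (a - d)]) (sq_nonneg _)
    linarith [pow_eq_zero_iff two_ne_zero |>.1 this]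
  subst ea eb
  have hprod' : 0 ≤ a * (α - a) := mul_nonneg hd (by linarith)
  have hβh : h * (h + β) ≤ 0 := by linarith
  have : β = -h := by
    have := nonpos_of_mul_nonpos_right hβh hh
    linarith
  subst this
  have := (abs_le.1 (abs_le_of_sq_le_sq (a := α) (b := a) (by linarith) hd)).2
  exact ⟨by linarith, rfl⟩

lemma norm_sq_coord (z : ℂ) : ‖z‖ ^ 2 = z.re ^ 2 + z.im ^ 2 := by
  rw [Complex.sq_norm, Complex.normSq_apply]; ring

lemma cap_contraction {n y p : ℂ} {d h : ℝ} (hn : ‖n‖ = 1) (hd : 0 ≤ d) (hh : h ≠ 0)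
    (hdh : d ^ 2 + h ^ 2 = 1) (hp : ‖p‖ ≤ 1) (hpc : 0 ≤ lineFn n d p) (hyc : lineFn n d y ≤ 0)
    (h1 : dist y (n * ⟨d, h⟩) ≤ dist p (n * ⟨d, h⟩))
    (h2 : dist y (n * ⟨d, -h⟩) ≤ dist p (n * ⟨d, -h⟩))
    (h3 : lineFn (n * ⟨d, h⟩) (d ^ 2 - h ^ 2) y ≤ 0) : y = p := by
  have hn2 : n.re ^ 2 + n.im ^ 2 = 1 := by rw [← norm_sq_coord, hn]; norm_num
  have hp2 : p.re ^ 2 + p.im ^ 2 ≤ 1 := by rw [← norm_sq_coord]; nlinarith [norm_nonneg p]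
  rw [dist_eq_norm, dist_eq_norm] at h1 h2
  have h1' := pow_le_pow_left₀ (norm_nonneg _) h1 2
  have h2' := pow_le_pow_left₀ (norm_nonneg _) h2 2
  simp only [norm_sq_coord, Complex.sub_re, Complex.sub_im, Complex.mul_re, Complex.mul_im]
    at h1' h2'
  simp only [lineFn, Complex.mul_re, Complex.mul_im] at h3 hpc hyc
  have rot : ∀ (x : ℂ) (k : ℝ), (x.re - (n.re * d - n.im * k)) ^ 2 +
      (x.im - (n.re * k + n.im * d)) ^ 2 = (n.re * x.re + n.im * x.im - d) ^ 2 +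
      (n.re * x.im - n.im * x.re - k) ^ 2 := by
    intro x k
    linear_combination (d ^ 2 + k ^ 2 - x.re ^ 2 - x.im ^ 2) * hn2
  rw [rot, rot] at h1' h2'
  have hpn : (n.re * p.re + n.im * p.im) ^ 2 + (n.re * p.im - n.im * p.re) ^ 2 ≤ 1 := by
    have : (n.re * p.re + n.im * p.im) ^ 2 + (n.re * p.im - n.im * p.re) ^ 2
        = p.re ^ 2 + p.im ^ 2 := by linear_combination (p.re ^ 2 + p.im ^ 2) * hn2
    linarith
  generalize hA : n.re * y.re + n.im * y.im = A at *
  generalize hB : n.re * y.im - n.im * y.re = B at *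
  generalize hP : n.re * p.re + n.im * p.im = P at *
  generalize hQ : n.re * p.im - n.im * p.re = Q at *
  have h3' : d * A + h * B ≤ d ^ 2 - h ^ 2 := by rw [← hA, ← hB]; linarith
  have main : A = P ∧ B = Q := by
    rcases lt_or_gt_of_ne hh with hneg | hpos
    · have := cap_contraction_coord (a := A) (b := -B) (α := P) (β := -Q) (d := d) (h := -h)
        hd (by linarith) (by linarith) (by linarith) (by linarith) (by linarith)
        (by linarith) (by linarith) (by linarith)
      exact ⟨this.1, by linarith [this.2]⟩
    · exact cap_contraction_coord (d := d) (h := h)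
        hd hpos (by linarith) (by linarith) (by linarith) (by linarith)
        (by linarith) (by linarith) (by linarith)
  subst hA hB
  obtain ⟨main1, main2⟩ := main
  rw [← hP] at main1
  rw [← hQ] at main2
  apply Complex.ext
  · linear_combination n.re * main1 - n.im * main2 + (p.re - y.re) * hn2
  · linear_combination n.im * main1 + n.re * main2 + (p.im - y.im) * hn2

/-- The angular width of a cap: if a chord with normal `n`, offset `d` lies in the unit disk then
its endpoints are `n * exp (± i arccos d)`. -/
lemma arccos_sq {d : ℝ} (h0 : -1 < d) (h1 : d < 1) :
    Real.cos (Real.arccos d) = d ∧ 0 < Real.sin (Real.arccos d) ∧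
      d ^ 2 + Real.sin (Real.arccos d) ^ 2 = 1 := by
  have hc := Real.cos_arccos h0.le h1.le
  refine ⟨hc, Real.sin_pos_of_pos_of_lt_pi (Real.arccos_pos.2 h1) ?_, ?_⟩
  · rcases (Real.arccos_le_pi d).lt_or_eq with h | h
    · exact h
    · rw [Real.arccos_eq_pi] at h; linarith
  · have := Real.sin_sq_add_cos_sq (Real.arccos d)
    rw [hc] at this; linarith

/-- Angular separation of two caps of the unit disk. -/
def CapsSeparated (n : ℂ) (d : ℝ) (n' : ℂ) (d' : ℝ) : Prop :=
  Real.arccos d + Real.arccos d' ≤ Real.arccos (n.re * n'.re + n.im * n'.im)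

lemma exists_angle {z : ℂ} (hz : ‖z‖ = 1) :
    ∃ θ : ℝ, -Real.pi < θ ∧ θ ≤ Real.pi ∧ z.re = Real.cos θ ∧ z.im = Real.sin θ := by
  have hz0 : z ≠ 0 := by rintro rfl; simp at hz
  refine ⟨Complex.arg z, Complex.neg_pi_lt_arg z, Complex.arg_le_pi z, ?_, ?_⟩
  · rw [Complex.cos_arg hz0, hz, div_one]
  · rw [Complex.sin_arg, hz, div_one]

lemma arccos_cos_le_abs (x : ℝ) : Real.arccos (Real.cos x) ≤ |x| := by
  rcases le_total |x| Real.pi with h | h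
  · rw [← Real.cos_abs, Real.arccos_cos (abs_nonneg x) h]
  · exact (Real.arccos_le_pi _).trans h

/-- If `x` ranges over a chord of the unit disk, an affine function is at most its maximum at the
endpoints. -/
lemma chord_le {n x w : ℂ} {d σ k : ℝ} (hn : ‖n‖ = 1) (hx : ‖x‖ ≤ 1) (hl : lineFn n d x = 0)
    (hd : d = Real.cos σ) (hs : 0 < Real.sin σ)
    (h1 : w.re * (n.re * Real.cos σ - n.im * Real.sin σ) +
      w.im * (n.im * Real.cos σ + n.re * Real.sin σ) ≤ k)
    (h2 : w.re * (n.re * Real.cos σ + n.im * Real.sin σ) +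
      w.im * (n.im * Real.cos σ - n.re * Real.sin σ) ≤ k) :
    w.re * x.re + w.im * x.im ≤ k := by
  have hn2 : n.re ^ 2 + n.im ^ 2 = 1 := by rw [← norm_sq_coord, hn]; norm_num
  have hx2 : x.re ^ 2 + x.im ^ 2 ≤ 1 := by rw [← norm_sq_coord]; nlinarith [norm_nonneg x]
  unfold lineFn at hl
  set τ := n.re * x.im - n.im * x.re with hτ
  have hsc := Real.sin_sq_add_cos_sq σ
  have e1 : x.re = n.re * d - n.im * τ := by
    rw [hτ]; linear_combination n.re * hl - x.re * hn2
  have e2 : x.im = n.im * d + n.re * τ := by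
    rw [hτ]; linear_combination n.im * hl - x.im * hn2
  have hτ2 : τ ^ 2 ≤ Real.sin σ ^ 2 := by
    have : x.re ^ 2 + x.im ^ 2 = d ^ 2 + τ ^ 2 := by
      rw [e1, e2]; linear_combination (d ^ 2 + τ ^ 2) * hn2
    rw [hd] at this
    linarith
  obtain ⟨t1, t2⟩ := abs_le.1 (abs_le_of_sq_le_sq hτ2 hs.le)
  rw [e1, e2, hd]
  set c := Real.cos σ
  set s := Real.sin σ
  have : w.re * (n.re * c - n.im * τ) + w.im * (n.im * c + n.re * τ)
    = (w.re * n.re + w.im * n.im) * c + (w.im * n.re - w.re * n.im) * τ := by ring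
  rw [this]
  rcases le_total 0 (w.im * n.re - w.re * n.im) with hq | hq <;> nlinarith

/-- Given three separated caps, the third at least as large as the first, the chord of the second
lies beyond the tangent to the reflection of the first cap at one of its endpoints. -/
lemma chord_beyond_tangent {n₁ n₂ n₃ y : ℂ} {d₁ d₂ d₃ : ℝ} (hn₁ : ‖n₁‖ = 1) (hn₂ : ‖n₂‖ = 1)
    (hn₃ : ‖n₃‖ = 1) (hd₁ : 0 ≤ d₁) (hd₁' : d₁ < 1) (hd₂ : 0 ≤ d₂) (hd₂' : d₂ < 1)
    (h₃₁ : d₃ ≤ d₁) (s₁₂ : CapsSeparated n₁ d₁ n₂ d₂)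
    (s₁₃ : CapsSeparated n₁ d₁ n₃ d₃) (s₂₃ : CapsSeparated n₂ d₂ n₃ d₃)
    (hy : ‖y‖ ≤ 1) (hyl : lineFn n₂ d₂ y = 0) :
    ∃ h : ℝ, h ≠ 0 ∧ d₁ ^ 2 + h ^ 2 = 1 ∧
      lineFn (n₁ * ⟨d₁, h⟩) (d₁ ^ 2 - h ^ 2) y ≤ 0 := by
  obtain ⟨c₁, p₁, q₁⟩ := arccos_sq (by linarith) hd₁'
  obtain ⟨c₂, p₂, q₂⟩ := arccos_sq (by linarith) hd₂'
  have hσ₃ : Real.arccos d₁ ≤ Real.arccos d₃ := Real.arccos_le_arccos h₃₁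
  set σ₁ := Real.arccos d₁
  set σ₂ := Real.arccos d₂
  set σ₃ := Real.arccos d₃
  have hσ₁ : 0 ≤ σ₁ := Real.arccos_nonneg _
  have hσ₂ : 0 ≤ σ₂ := Real.arccos_nonneg _
  have hn2 : n₁.re ^ 2 + n₁.im ^ 2 = 1 := by rw [← norm_sq_coord, hn₁]; norm_num
  have par : ∀ m : ℂ, ‖m‖ = 1 → ∃ μ : ℝ, |μ| ≤ Real.pi ∧
      m.re = -(n₁.re * Real.cos μ - n₁.im * Real.sin μ) ∧
      m.im = -(n₁.im * Real.cos μ + n₁.re * Real.sin μ) := by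
    intro m hm
    obtain ⟨θ, h1, h2, h3, h4⟩ := exists_angle (z := -(starRingEnd ℂ n₁ * m))
      (by rw [norm_neg, norm_mul, RCLike.norm_conj, hn₁, hm, one_mul])
    refine ⟨θ, abs_le.2 ⟨h1.le, h2⟩, ?_, ?_⟩
    · rw [← h3, ← h4]; simp; linear_combination (-m.re) * hn2
    · rw [← h3, ← h4]; simp; linear_combination (-m.im) * hn2
  obtain ⟨μ₂, m₂, r₂, i₂⟩ := par n₂ hn₂
  obtain ⟨μ₃, m₃, r₃, i₃⟩ := par n₃ hn₃
  have b₂ : |μ₂| ≤ Real.pi - σ₁ - σ₂ := by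
    have : n₁.re * n₂.re + n₁.im * n₂.im = Real.cos (Real.pi - |μ₂|) := by
      rw [Real.cos_pi_sub, Real.cos_abs, r₂, i₂]; linear_combination (-Real.cos μ₂) * hn2
    have h := s₁₂
    rw [CapsSeparated, this, Real.arccos_cos (by linarith) (by linarith [abs_nonneg μ₂])] at h
    linarith
  have b₃ : |μ₃| ≤ Real.pi - σ₁ - σ₃ := by
    have : n₁.re * n₃.re + n₁.im * n₃.im = Real.cos (Real.pi - |μ₃|) := by
      rw [Real.cos_pi_sub, Real.cos_abs, r₃, i₃]; linear_combination (-Real.cos μ₃) * hn2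
    have h := s₁₃
    rw [CapsSeparated, this, Real.arccos_cos (by linarith) (by linarith [abs_nonneg μ₃])] at h
    linarith
  have b₂₃ : σ₂ + σ₃ ≤ |μ₂ - μ₃| := by
    have : n₂.re * n₃.re + n₂.im * n₃.im = Real.cos (μ₂ - μ₃) := by
      rw [Real.cos_sub, r₃, i₃, r₂, i₂]
      linear_combination (Real.cos μ₂ * Real.cos μ₃ + Real.sin μ₂ * Real.sin μ₃) * hn2
    have h := s₂₃
    rw [CapsSeparated, this] at h
    exact h.trans (arccos_cos_le_abs _)
  obtain ⟨b₂l, b₂r⟩ := abs_le.1 b₂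
  obtain ⟨b₃l, b₃r⟩ := abs_le.1 b₃
  have far : ∀ x : ℝ, 2 * σ₁ ≤ x → x ≤ 2 * Real.pi - 2 * σ₁ →
      Real.cos x ≤ d₁ ^ 2 - Real.sin σ₁ ^ 2 := by
    intro x hx1 hx2
    have : d₁ ^ 2 - Real.sin σ₁ ^ 2 = Real.cos (2 * σ₁) := by
      rw [Real.cos_two_mul', c₁]
    rw [this]
    rcases le_total x Real.pi with h | h
    · exact Real.cos_le_cos_of_nonneg_of_le_pi (by linarith) h hx1
    · rw [← Real.cos_two_pi_sub x]
      exact Real.cos_le_cos_of_nonneg_of_le_pi (by linarith) (by linarith) (by linarith)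
  rcases le_total μ₃ μ₂ with hle | hle
  · rw [abs_of_nonneg (by linarith)] at b₂₃
    refine ⟨Real.sin σ₁, p₁.ne', q₁, ?_⟩
    have f₁ := far (μ₂ + σ₂ + Real.pi - σ₁) (by linarith) (by linarith)
    have f₂ := far (μ₂ - σ₂ + Real.pi - σ₁) (by linarith) (by linarith)
    have := chord_le (w := n₁ * ⟨d₁, Real.sin σ₁⟩) (k := d₁ ^ 2 - Real.sin σ₁ ^ 2)
      hn₂ hy hyl c₂.symm p₂ (le_of_eq_of_le ?_ f₁) (le_of_eq_of_le ?_ f₂)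
    · unfold lineFn; linarith
    · rw [show μ₂ + σ₂ + Real.pi - σ₁ = (μ₂ + σ₂) - σ₁ + Real.pi by ring, Real.cos_add_pi,
        Real.cos_sub, Real.cos_add, Real.sin_add, c₁, r₂, i₂]
      simp only [Complex.mul_re, Complex.mul_im]
      linear_combination (-(d₁ * (Real.cos μ₂ * Real.cos σ₂ - Real.sin μ₂ * Real.sin σ₂)
        + Real.sin σ₁ * (Real.sin μ₂ * Real.cos σ₂ + Real.cos μ₂ * Real.sin σ₂))) * hn2
    · rw [show μ₂ - σ₂ + Real.pi - σ₁ = (μ₂ - σ₂) - σ₁ + Real.pi by ring, Real.cos_add_pi,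
        Real.cos_sub, Real.cos_sub, Real.sin_sub, c₁, r₂, i₂]
      simp only [Complex.mul_re, Complex.mul_im]
      linear_combination (-(d₁ * (Real.cos μ₂ * Real.cos σ₂ + Real.sin μ₂ * Real.sin σ₂)
        + Real.sin σ₁ * (Real.sin μ₂ * Real.cos σ₂ - Real.cos μ₂ * Real.sin σ₂))) * hn2
  · rw [abs_of_nonpos (by linarith)] at b₂₃
    refine ⟨-Real.sin σ₁, (neg_neg_of_pos p₁).ne, by rw [neg_sq]; exact q₁, ?_⟩
    have f₁ := far (-(μ₂ + σ₂) + Real.pi - σ₁) (by linarith) (by linarith)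
    have f₂ := far (-(μ₂ - σ₂) + Real.pi - σ₁) (by linarith) (by linarith)
    have := chord_le (w := n₁ * ⟨d₁, -Real.sin σ₁⟩) (k := d₁ ^ 2 - Real.sin σ₁ ^ 2)
      hn₂ hy hyl c₂.symm p₂ (le_of_eq_of_le ?_ f₁) (le_of_eq_of_le ?_ f₂)
    · unfold lineFn; rw [neg_sq]; linarith
    · rw [show -(μ₂ + σ₂) + Real.pi - σ₁ = -((μ₂ + σ₂) + σ₁) + Real.pi by ring, Real.cos_add_pi,
        Real.cos_neg, Real.cos_add, Real.cos_add, Real.sin_add, c₁, r₂, i₂]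
      simp only [Complex.mul_re, Complex.mul_im]
      linear_combination (-(d₁ * (Real.cos μ₂ * Real.cos σ₂ - Real.sin μ₂ * Real.sin σ₂)
        - Real.sin σ₁ * (Real.sin μ₂ * Real.cos σ₂ + Real.cos μ₂ * Real.sin σ₂))) * hn2
    · rw [show -(μ₂ - σ₂) + Real.pi - σ₁ = -((μ₂ - σ₂) + σ₁) + Real.pi by ring, Real.cos_add_pi,
        Real.cos_neg, Real.cos_add, Real.cos_sub, Real.sin_sub, c₁, r₂, i₂]
      simp only [Complex.mul_re, Complex.mul_im]
      linear_combination (-(d₁ * (Real.cos μ₂ * Real.cos σ₂ + Real.sin μ₂ * Real.sin σ₂)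
        - Real.sin σ₁ * (Real.sin μ₂ * Real.cos σ₂ - Real.cos μ₂ * Real.sin σ₂))) * hn2

/-- A family of pairwise non-crossing chords of the unit disk. The `i`-th chord lies on the line
`lineFn (n i) (d i) = 0` and the closed cap where this function is nonnegative does not contain the
center of the disk in its interior. -/
structure ChordSystem (ι : Type*) where
  n : ι → ℂ
  d : ι → ℝ
  norm_n : ∀ i, ‖n i‖ = 1
  d_nonneg : ∀ i, 0 ≤ d i
  d_lt_one : ∀ i, d i < 1
  noncross : ∀ i j, i ≠ j → ∀ x : ℂ, ‖x‖ < 1 → lineFn (n i) (d i) x = 0 →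
    lineFn (n j) (d j) x ≠ 0

namespace ChordSystem

variable {ι : Type*} (S : ChordSystem ι)

/-- The signed distance to the `i`-th chord. -/
def ℓ (i : ι) (x : ℂ) : ℝ := lineFn (S.n i) (S.d i) x

/-- The midpoint of the `i`-th chord. -/
def mid (i : ι) : ℂ := S.d i * S.n i

/-- The cap of the chord `i` strictly contains the cap of the chord `j`. -/
def Anc (i j : ι) : Prop := 0 < S.ℓ i (S.mid j)

/-- The `i`-th chord. -/
def chord (i : ι) : Set ℂ := {x | ‖x‖ ≤ 1 ∧ S.ℓ i x = 0}

lemma ℓ_combo (i : ι) (x y : ℂ) (t : ℝ) :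
    S.ℓ i ((1 - t : ℝ) * x + t * y) = (1 - t) * S.ℓ i x + t * S.ℓ i y := by
  simp [ℓ, lineFn]; ring

lemma continuous_ℓ (i : ι) : Continuous (S.ℓ i) := by
  unfold ℓ lineFn; fun_prop

lemma n_sq (i : ι) : (S.n i).re ^ 2 + (S.n i).im ^ 2 = 1 := by
  rw [← norm_sq_coord, S.norm_n]; norm_num

lemma norm_mid (i : ι) : ‖S.mid i‖ = S.d i := by
  simp [mid, S.norm_n, abs_of_nonneg (S.d_nonneg i)]

lemma norm_mid_lt (i : ι) : ‖S.mid i‖ < 1 := by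
  rw [norm_mid]; exact S.d_lt_one i

lemma ℓ_mid (i j : ι) :
    S.ℓ i (S.mid j) = S.d j * ((S.n i).re * (S.n j).re + (S.n i).im * (S.n j).im) - S.d i := by
  simp [ℓ, lineFn, mid]; ring

lemma ℓ_mid_self (i : ι) : S.ℓ i (S.mid i) = 0 := by
  rw [ℓ_mid]; linear_combination S.d i * S.n_sq i

lemma norm_combo_le {x y : ℂ} {t : ℝ} (ht : 0 ≤ t) (ht1 : t ≤ 1) (hx : ‖x‖ ≤ 1) (hy : ‖y‖ ≤ 1) :
    ‖((1 - t : ℝ) : ℂ) * x + t * y‖ ≤ 1 := by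
  have h := norm_add_le (((1 - t : ℝ) : ℂ) * x) (t * y)
  rw [norm_mul, norm_mul, Complex.norm_real, Complex.norm_real, Real.norm_of_nonneg ht,
    Real.norm_of_nonneg (sub_nonneg.2 ht1)] at h
  nlinarith

lemma norm_combo_lt {x y : ℂ} {t : ℝ} (ht : 0 ≤ t) (ht1 : t < 1) (hx : ‖x‖ < 1) (hy : ‖y‖ ≤ 1) :
    ‖((1 - t : ℝ) : ℂ) * x + t * y‖ < 1 := by
  have h := norm_add_le (((1 - t : ℝ) : ℂ) * x) (t * y)
  rw [norm_mul, norm_mul, Complex.norm_real, Complex.norm_real, Real.norm_of_nonneg ht,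
    Real.norm_of_nonneg (sub_nonneg.2 ht1.le)] at h
  nlinarith

lemma exists_zero (i : ι) {x y : ℂ} (h : S.ℓ i x * S.ℓ i y < 0) :
    ∃ t : ℝ, 0 < t ∧ t < 1 ∧ S.ℓ i ((1 - t : ℝ) * x + t * y) = 0 := by
  have hne : S.ℓ i x - S.ℓ i y ≠ 0 := by
    intro h0
    have : S.ℓ i x = S.ℓ i y := by linarith
    rw [this] at h
    nlinarith [mul_self_nonneg (S.ℓ i y)]
  refine ⟨S.ℓ i x / (S.ℓ i x - S.ℓ i y), ?_, ?_, ?_⟩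
  · rcases mul_neg_iff.1 h with ⟨h1, h2⟩ | ⟨h1, h2⟩
    · exact div_pos h1 (by linarith)
    · exact div_pos_of_neg_of_neg h1 (by linarith)
  · rcases mul_neg_iff.1 h with ⟨h1, h2⟩ | ⟨h1, h2⟩
    · rw [div_lt_one (by linarith)]; linarith
    · rw [div_lt_one_of_neg (by linarith)]; linarith
  · rw [ℓ_combo]; field_simp; ring

lemma ℓ_mid_ne {i j : ι} (h : i ≠ j) : S.ℓ i (S.mid j) ≠ 0 := fun h0 =>
  S.noncross i j h _ (S.norm_mid_lt j) h0 (S.ℓ_mid_self j)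

lemma mul_chord_nonneg {i j : ι} (hij : i ≠ j) {x : ℂ} (hx : x ∈ S.chord j) :
    0 ≤ S.ℓ i (S.mid j) * S.ℓ i x := by
  by_contra h
  push Not at h
  obtain ⟨t, h0, h1, ht⟩ := S.exists_zero i h
  refine S.noncross i j hij _ (norm_combo_lt h0.le h1 (S.norm_mid_lt j) hx.1) ht ?_
  change S.ℓ j _ = 0
  rw [ℓ_combo, ℓ_mid_self, hx.2]; ring

lemma nonneg_of_anc {i j : ι} (h : S.Anc i j) {x : ℂ} (hx : x ∈ S.chord j) : 0 ≤ S.ℓ i x := by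
  have hij : i ≠ j := by
    rintro rfl
    exact h.ne' (S.ℓ_mid_self i)
  exact nonneg_of_mul_nonneg_right (S.mul_chord_nonneg hij hx) h

lemma nonpos_of_not_anc {i j : ι} (h : ¬ S.Anc i j) {x : ℂ} (hx : x ∈ S.chord j) :
    S.ℓ i x ≤ 0 := by
  rcases eq_or_ne i j with rfl | hij
  · exact hx.2.le
  have h0 : S.ℓ i (S.mid j) < 0 := lt_of_le_of_ne (not_lt.1 h) (S.ℓ_mid_ne hij)
  have := S.mul_chord_nonneg hij hx
  by_contra hc
  push Not at hc
  nlinarith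

lemma d_lt_of_anc {i j : ι} (h : S.Anc i j) : S.d i < S.d j := by
  have h' := h
  rw [Anc, ℓ_mid] at h'
  have h1 := S.n_sq i
  have h2 := S.n_sq j
  have : (S.n i).re * (S.n j).re + (S.n i).im * (S.n j).im ≤ 1 := by
    nlinarith [sq_nonneg ((S.n i).re - (S.n j).re), sq_nonneg ((S.n i).im - (S.n j).im)]
  nlinarith [S.d_nonneg j]

lemma anc_irrefl (i : ι) : ¬ S.Anc i i := fun h => lt_irrefl _ (S.d_lt_of_anc h)

lemma anc_asymm {i j : ι} (h : S.Anc i j) : ¬ S.Anc j i := fun h' =>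
  lt_asymm (S.d_lt_of_anc h) (S.d_lt_of_anc h')

lemma pos_of_anc {i j : ι} (h : S.Anc i j) {p : ℂ} (hp : ‖p‖ ≤ 1) (hj : 0 < S.ℓ j p) :
    0 < S.ℓ i p := by
  by_contra hc
  push Not at hc
  have key : ∀ z : ℂ, ‖z‖ ≤ 1 → S.ℓ i z = 0 → S.ℓ j z ≤ 0 := fun z hz h0 =>
    S.nonpos_of_not_anc (S.anc_asymm h) ⟨hz, h0⟩
  rcases hc.lt_or_eq with hlt | heq
  · obtain ⟨t, h0, h1, ht⟩ := S.exists_zero i (mul_neg_of_pos_of_neg h hlt)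
    have := key _ (norm_combo_le h0.le h1.le (S.norm_mid_lt j).le hp) ht
    rw [ℓ_combo, ℓ_mid_self] at this
    nlinarith
  · exact absurd (key p hp heq) (not_le.2 hj)

lemma anc_trans {i j k : ι} (h : S.Anc i j) (h' : S.Anc j k) : S.Anc i k :=
  S.pos_of_anc h (S.norm_mid_lt k).le h'

lemma anc_or_anc {i j : ι} (hij : i ≠ j) {p : ℂ} (hp : ‖p‖ ≤ 1) (hi : 0 < S.ℓ i p)
    (hj : 0 < S.ℓ j p) : S.Anc i j ∨ S.Anc j i := by
  by_contra! hc
  have h0 : S.ℓ i (S.mid j) < 0 := lt_of_le_of_ne (not_lt.1 hc.1) (S.ℓ_mid_ne hij)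
  obtain ⟨t, h0, h1, ht⟩ := S.exists_zero i (mul_neg_of_neg_of_pos h0 hi)
  have := S.nonpos_of_not_anc hc.2 (x := _)
    ⟨norm_combo_le h0.le h1.le (S.norm_mid_lt j).le hp, ht⟩
  rw [ℓ_combo, ℓ_mid_self] at this
  nlinarith

lemma anc_comparable {i j k : ι} (hij : i ≠ j) (hi : S.Anc i k) (hj : S.Anc j k) :
    S.Anc i j ∨ S.Anc j i :=
  S.anc_or_anc hij (S.norm_mid_lt k).le hi hj

/-- The chords having a face on the side of their caps; a face is labelled by the chord cutting it
off from the center, or by `none`. -/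
def up : Option ι → Set ι
  | none => ∅
  | some i => {j | j = i ∨ S.Anc j i}

/-- The closed faces cut out by the chords. -/
def face (a : Option ι) : Set ℂ :=
  {x | ‖x‖ ≤ 1 ∧ (∀ i ∈ S.up a, 0 ≤ S.ℓ i x) ∧ ∀ i ∉ S.up a, S.ℓ i x ≤ 0}

lemma up_injective : Function.Injective S.up := by
  rintro (_ | i) (_ | j) h
  · rfl
  · have : j ∈ S.up none := by rw [h]; exact Or.inl rfl
    exact absurd this (by simp [up])
  · have : i ∈ S.up none := by rw [← h]; exact Or.inl rfl
    exact absurd this (by simp [up])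
  · have h1 : j ∈ S.up (some i) := by rw [h]; exact Or.inl rfl
    have h2 : i ∈ S.up (some j) := by rw [← h]; exact Or.inl rfl
    rcases h1 with rfl | h1
    · rfl
    rcases h2 with rfl | h2
    · rfl
    exact absurd h1 (S.anc_asymm h2)

lemma exists_up_iff [Finite ι] {p : ℂ} (hp : ‖p‖ ≤ 1) :
    ∃ a, ∀ i, i ∈ S.up a ↔ 0 < S.ℓ i p := by
  rcases Set.eq_empty_or_nonempty {i | 0 < S.ℓ i p} with h | h
  · refine ⟨none, fun i => ?_⟩
    have : i ∉ {i | 0 < S.ℓ i p} := by rw [h]; simp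
    simpa [up] using this
  · obtain ⟨e, he, hmax⟩ := Set.exists_max_image _ S.d (Set.toFinite _) h
    refine ⟨some e, fun i => ⟨?_, fun hi => ?_⟩⟩
    · rintro (rfl | hi)
      · exact he
      · exact S.pos_of_anc hi hp he
    · by_contra hc
      simp only [up, Set.mem_ofPred_eq, not_or] at hc
      rcases S.anc_or_anc hc.1 hp hi he with h | h
      · exact hc.2 h
      · exact (S.d_lt_of_anc h).not_ge (hmax i hi)

/-- The face on the other side of the chord `i` from its cap. -/
lemma exists_parent [Finite ι] (i : ι) : ∃ a, ∀ j, j ∈ S.up a ↔ S.Anc j i :=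
  S.exists_up_iff (S.norm_mid_lt i).le

lemma exists_mem_face [Finite ι] {p : ℂ} (hp : ‖p‖ ≤ 1) : ∃ a, p ∈ S.face a := by
  obtain ⟨a, ha⟩ := S.exists_up_iff hp
  exact ⟨a, hp, fun i hi => ((ha i).1 hi).le, fun i hi => not_lt.1 fun h => hi ((ha i).2 h)⟩

lemma chord_subset_face {i : ι} {a : Option ι} (ha : ∀ j, j ≠ i → (j ∈ S.up a ↔ S.Anc j i)) :
    S.chord i ⊆ S.face a := by
  intro x hx
  refine ⟨hx.1, fun j hj => ?_, fun j hj => ?_⟩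
  · rcases eq_or_ne j i with rfl | hji
    · exact hx.2.ge
    · exact S.nonneg_of_anc ((ha j hji).1 hj) hx
  · rcases eq_or_ne j i with rfl | hji
    · exact hx.2.le
    · exact S.nonpos_of_not_anc (fun h => hj ((ha j hji).2 h)) hx

lemma chord_subset_face_some (i : ι) : S.chord i ⊆ S.face (some i) :=
  S.chord_subset_face fun j hj => by simp [up, hj]

lemma isClosed_face (a : Option ι) : IsClosed (S.face a) := by
  have : S.face a = Metric.closedBall 0 1 ∩ ((⋂ i ∈ S.up a, {x | 0 ≤ S.ℓ i x}) ∩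
      ⋂ i ∈ (S.up a)ᶜ, {x | S.ℓ i x ≤ 0}) := by
    ext x; simp [face]
  rw [this]
  refine Metric.isClosed_closedBall.inter (IsClosed.inter ?_ ?_)
  · exact isClosed_biInter fun i _ => isClosed_le continuous_const (S.continuous_ℓ i)
  · exact isClosed_biInter fun i _ => isClosed_le (S.continuous_ℓ i) continuous_const

lemma isCompact_chord (i : ι) : IsCompact (S.chord i) := by
  have : S.chord i = Metric.closedBall 0 1 ∩ {x | S.ℓ i x = 0} := by
    ext x; simp [chord]
  rw [this]
  exact (isCompact_closedBall 0 1).inter_right (isClosed_eq (S.continuous_ℓ i) continuous_const)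

lemma mid_mem_chord (i : ι) : S.mid i ∈ S.chord i := ⟨(S.norm_mid_lt i).le, S.ℓ_mid_self i⟩

/-- Two faces meeting at a point are connected by crossing chords through that point. -/
lemma eqvGen_of_mem_face [Finite ι] (parent : ι → Option ι)
    (hparent : ∀ i j, j ∈ S.up (parent i) ↔ S.Anc j i) {p : ℂ} {a b : Option ι}
    (ha : p ∈ S.face a) (hb : p ∈ S.face b) :
    Relation.EqvGen (fun a b => ∃ i, p ∈ S.chord i ∧ a = some i ∧ b = parent i) a b := by
  set r := fun a b => ∃ i, p ∈ S.chord i ∧ a = some i ∧ b = parent i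
  have key : ∀ a, p ∈ S.face a → ∃ c, Relation.EqvGen r a c ∧ ∀ i, i ∈ S.up c ↔ 0 < S.ℓ i p := by
    intro a ha
    obtain ⟨c, ⟨hac, hc⟩, hmin⟩ := Set.exists_min_image {c | Relation.EqvGen r a c ∧ p ∈ S.face c}
      (fun c => (S.up c).ncard) (Set.toFinite _) ⟨a, Relation.EqvGen.refl a, ha⟩
    refine ⟨c, hac, ?_⟩
    rcases c with _ | e
    · intro i
      simpa [up] using hc.2.2 i (by simp [up])
    have hpos : 0 < S.ℓ e p := by
      refine lt_of_le_of_ne (hc.2.1 e (Or.inl rfl)) fun h0 => ?_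
      have hpe : p ∈ S.chord e := ⟨hc.1, h0.symm⟩
      have h1 := hmin (parent e) ⟨hac.trans _ _ _ (Relation.EqvGen.rel _ _ ⟨e, hpe, rfl, rfl⟩),
        S.chord_subset_face (fun j _ => hparent e j) hpe⟩
      refine h1.not_gt (Set.ncard_lt_ncard ⟨fun j hj => Or.inr ((hparent e j).1 hj), fun h => ?_⟩)
      exact S.anc_irrefl e ((hparent e e).1 (h (Or.inl rfl)))
    refine fun i => ⟨?_, fun hi => by_contra fun h => (hc.2.2 i h).not_gt hi⟩
    rintro (rfl | hi)
    · exact hpos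
    · exact S.pos_of_anc hi hc.1 hpos
  obtain ⟨c, hc, hc'⟩ := key a ha
  obtain ⟨c', hd, hd'⟩ := key b hb
  have : c = c' := S.up_injective (by ext i; rw [hc', hd'])
  subst this
  exact hc.trans _ _ _ (hd.symm _ _)

/-- Every nonempty closed face is the closure of its interior. -/
lemma exists_interior_point [Finite ι] (a : Option ι) :
    ∃ z : ℂ, ‖z‖ < 1 ∧ (∀ i ∈ S.up a, 0 < S.ℓ i z) ∧ ∀ i ∉ S.up a, S.ℓ i z < 0 := by
  have perturb : ∀ (e : ι) (s : ℝ), s ≠ 0 → ∃ z : ℂ, ‖z‖ < 1 ∧ 0 < s * S.ℓ e z ∧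
      ∀ i, i ≠ e → 0 < S.ℓ i (S.mid e) * S.ℓ i z := by
    intro e s hs
    have hc : Continuous fun t : ℝ => S.mid e + (t * s : ℝ) * S.n e := by fun_prop
    have h1 : ∀ᶠ t in nhds (0 : ℝ), ‖S.mid e + (t * s : ℝ) * S.n e‖ < 1 :=
      hc.norm.continuousAt.eventually_lt continuousAt_const (by simpa using S.norm_mid_lt e)
    have h2 : ∀ᶠ t in nhds (0 : ℝ), ∀ i, i ≠ e →
        0 < S.ℓ i (S.mid e) * S.ℓ i (S.mid e + (t * s : ℝ) * S.n e) := by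
      rw [Filter.eventually_all]
      intro i
      by_cases hi : i = e
      · simp [hi]
      · have : ContinuousAt (fun t : ℝ => S.ℓ i (S.mid e) * S.ℓ i (S.mid e + (t * s : ℝ) * S.n e))
          0 :=
          (continuous_const.mul ((S.continuous_ℓ i).comp hc)).continuousAt
        have h3 := (continuousAt_const (y := (0 : ℝ))).eventually_lt this (by
          simpa only [zero_mul, Complex.ofReal_zero, add_zero] using mul_self_pos.2 (S.ℓ_mid_ne hi))
        filter_upwards [h3] with t ht _ using ht
    obtain ⟨t, ⟨ht1, ht2⟩, ht0⟩ := ((h1.and h2).filter_mono nhdsWithin_le_nhds |>.and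
      (self_mem_nhdsWithin : Set.Ioi (0 : ℝ) ∈ nhdsWithin 0 (Set.Ioi 0))).exists
    refine ⟨_, ht1, ?_, ht2⟩
    have : S.ℓ e (S.mid e + (t * s : ℝ) * S.n e) = t * s := by
      have h := S.ℓ_mid_self e
      have h' := S.n_sq e
      simp only [ℓ, lineFn] at h ⊢
      simp
      linear_combination h + t * s * h'
    rw [this]
    have := mul_pos (show 0 < t from ht0) (mul_self_pos.2 hs)
    linarith
  rcases a with _ | e
  · rcases isEmpty_or_nonempty ι with hι | hι
    · exact ⟨0, by simp, fun i => isEmptyElim i, fun i => isEmptyElim i⟩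
    obtain ⟨e, he⟩ := Finite.exists_min S.d
    obtain ⟨z, h1, h2, h3⟩ := perturb e (-1) (by norm_num)
    refine ⟨z, h1, by simp [up], fun i _ => ?_⟩
    rcases eq_or_ne i e with rfl | hi
    · linarith
    have : ¬ S.Anc i e := fun h => (he i).not_gt (S.d_lt_of_anc h)
    rw [Anc, not_lt] at this
    by_contra hc
    push Not at hc
    nlinarith [h3 i hi]
  · obtain ⟨z, h1, h2, h3⟩ := perturb e 1 one_ne_zero
    refine ⟨z, h1, ?_, fun i hi => ?_⟩
    · rintro i (rfl | hi)
      · linarith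
      · have hie : i ≠ e := by rintro rfl; exact S.anc_irrefl i hi
        exact (mul_pos_iff_of_pos_left hi).1 (h3 i hie)
    · simp only [up, Set.mem_ofPred_eq, not_or] at hi
      have := hi.2
      rw [Anc, not_lt] at this
      by_contra hc
      push Not at hc
      nlinarith [h3 i hi.1]

lemma dist_eq_of_mem_face [Finite ι] {φ : ℂ → ℂ} (hφ : ContinuousOn φ (Metric.closedBall 0 1))
    (hiso : ∀ x y : ℂ, ‖x‖ < 1 → ‖y‖ < 1 →
      (∀ i, (0 < S.ℓ i x ∧ 0 < S.ℓ i y) ∨ (S.ℓ i x < 0 ∧ S.ℓ i y < 0)) →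
      dist (φ x) (φ y) = dist x y) {a : Option ι} {x y : ℂ}
    (hx : x ∈ S.face a) (hy : y ∈ S.face a) : dist (φ x) (φ y) = dist x y := by
  obtain ⟨z, hz, hz1, hz2⟩ := S.exists_interior_point a
  set g : ℂ → ℝ → ℂ := fun p t => ((1 - t : ℝ) : ℂ) * z + t * p with hg
  have tend : ∀ p, Filter.Tendsto (g p) (nhdsWithin 1 (Set.Ioo 0 1)) (nhds p) := by
    intro p
    have : Continuous (g p) := by fun_prop
    have h := this.tendsto 1
    simp only [hg, sub_self, Complex.ofReal_zero, zero_mul, zero_add, Complex.ofReal_one, one_mul]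
      at h
    exact h.mono_left nhdsWithin_le_nhds
  have tendφ : ∀ p ∈ S.face a, Filter.Tendsto (fun t => φ (g p t)) (nhdsWithin 1 (Set.Ioo 0 1))
      (nhds (φ p)) := by
    intro p hp
    refine (hφ p (by simpa using hp.1)).tendsto.comp ?_
    refine tendsto_nhdsWithin_iff.2 ⟨tend p, ?_⟩
    filter_upwards [self_mem_nhdsWithin] with t ht
    rw [mem_closedBall_zero_iff]
    exact norm_combo_le ht.1.le ht.2.le hz.le hp.1
  have hne : (nhdsWithin (1 : ℝ) (Set.Ioo 0 1)).NeBot := by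
    apply mem_closure_iff_nhdsWithin_neBot.1
    rw [closure_Ioo zero_ne_one]; simp
  refine tendsto_nhds_unique ((tendφ x hx).dist (tendφ y hy)) ?_
  refine ((tend x).dist (tend y)).congr' ?_
  filter_upwards [self_mem_nhdsWithin] with t ht
  have sgn : ∀ p ∈ S.face a, (∀ i ∈ S.up a, 0 < S.ℓ i (g p t)) ∧
      ∀ i ∉ S.up a, S.ℓ i (g p t) < 0 := by
    intro p hp
    refine ⟨fun i hi => ?_, fun i hi => ?_⟩
    · rw [hg, ℓ_combo]
      nlinarith [mul_pos (sub_pos.2 ht.2) (hz1 i hi), mul_nonneg ht.1.le (hp.2.1 i hi)]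
    · rw [hg, ℓ_combo]
      have := mul_neg_of_pos_of_neg (sub_pos.2 ht.2) (hz2 i hi)
      have := mul_nonpos_of_nonneg_of_nonpos ht.1.le (hp.2.2 i hi)
      linarith
  refine (hiso _ _ (norm_combo_lt ht.1.le ht.2 hz hx.1) (norm_combo_lt ht.1.le ht.2 hz hy.1)
    fun i => ?_).symm
  by_cases hi : i ∈ S.up a
  · exact Or.inl ⟨(sgn x hx).1 i hi, (sgn y hy).1 i hi⟩
  · exact Or.inr ⟨(sgn x hx).2 i hi, (sgn y hy).2 i hi⟩

/-- A linear order listing every chord before its descendants, and the descendants of each chord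
consecutively. -/
lemma exists_preorder (s : Finset ι) : ∃ r : ι → ℝ, Set.InjOn r s ∧
    (∀ e ∈ s, ∀ f ∈ s, S.Anc f e → r f < r e) ∧
    ∀ e ∈ s, ∀ c ∈ s, ∀ f ∈ s, S.Anc e f → r e < r c → r c < r f → S.Anc e c := by
  classical
  induction s using Finset.induction_on_max_value S.d with
  | empty => exact ⟨0, by simp⟩
  | insert x s hx hmax ih =>
    obtain ⟨r, hinj, h1, h2⟩ := ih
    have hxs : ∀ e ∈ s, ¬ S.Anc x e := fun e he h => (S.d_lt_of_anc h).not_ge (hmax e he)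
    set L := s.filter fun c => ∃ a ∈ s, S.Anc a x ∧ r c ≤ r a with hL
    obtain ⟨t, ht1, ht2⟩ := Order.exists_between_finsets (L.image r) ((s \ L).image r) (by
      intro y hy z hz
      obtain ⟨c, hc, rfl⟩ := Finset.mem_image.1 hy
      obtain ⟨c', hc', rfl⟩ := Finset.mem_image.1 hz
      obtain ⟨hcs, a, ha, hax, hca⟩ := Finset.mem_filter.1 hc
      obtain ⟨hcs', hn⟩ := Finset.mem_sdiff.1 hc'
      by_contra h
      exact hn (Finset.mem_filter.2 ⟨hcs', a, ha, hax, (not_lt.1 h).trans hca⟩))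
    have lo : ∀ c ∈ L, r c < t := fun c hc => ht1 _ (Finset.mem_image_of_mem _ hc)
    have hi : ∀ c ∈ s, c ∉ L → t < r c := fun c hc hc' =>
      ht2 _ (Finset.mem_image_of_mem _ (Finset.mem_sdiff.2 ⟨hc, hc'⟩))
    have hne : ∀ c ∈ s, r c ≠ t := fun c hc => by
      by_cases h : c ∈ L
      · exact (lo c h).ne
      · exact (hi c hc h).ne'
    have memL : ∀ c ∈ s, r c < t → ∃ a ∈ s, S.Anc a x ∧ r c ≤ r a := fun c hc h => by
      by_contra hn
      exact h.not_gt (hi c hc fun h' => hn (Finset.mem_filter.1 h').2)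
    have ancL : ∀ c ∈ s, S.Anc c x → r c < t := fun c hc h =>
      lo c (Finset.mem_filter.2 ⟨hc, c, hc, h, le_rfl⟩)
    have hup : ∀ c ∈ s, Function.update r x t c = r c := fun c hc =>
      Function.update_of_ne (by rintro rfl; exact hx hc) _ _
    have hux : Function.update r x t x = t := Function.update_self _ _ _
    refine ⟨Function.update r x t, ?_, ?_, ?_⟩
    · intro a ha b hb hab
      rcases Finset.mem_insert.1 ha with rfl | ha' <;> rcases Finset.mem_insert.1 hb with rfl | hb'
      · rfl
      · rw [hux, hup b hb'] at hab; exact absurd hab.symm (hne b hb')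
      · rw [hux, hup a ha'] at hab; exact absurd hab (hne a ha')
      · rw [hup a ha', hup b hb'] at hab; exact hinj ha' hb' hab
    · intro e he f hf hfe
      rcases Finset.mem_insert.1 he with rfl | he' <;> rcases Finset.mem_insert.1 hf with rfl | hf'
      · exact absurd hfe (S.anc_irrefl _)
      · rw [hux, hup f hf']; exact ancL f hf' hfe
      · exact absurd hfe (hxs e he')
      · rw [hup e he', hup f hf']; exact h1 e he' f hf' hfe
    · intro e he c hc f hf hef hec hcf
      have hex : e ∈ s := by
        rcases Finset.mem_insert.1 he with rfl | he'
        · rcases Finset.mem_insert.1 hf with rfl | hf'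
          · exact absurd hef (S.anc_irrefl _)
          · exact absurd hef (hxs f hf')
        · exact he'
      rw [hup e hex] at hec
      rcases Finset.mem_insert.1 hc with rfl | hc'
      · rw [hux] at hec hcf
        rcases Finset.mem_insert.1 hf with rfl | hf'
        · exact hef
        rw [hup f hf'] at hcf
        obtain ⟨a, ha, hac, hea⟩ := memL e hex hec
        rcases hea.eq_or_lt with h | h
        · rwa [hinj hex ha h]
        · exact S.anc_trans (h2 e hex a ha f hf' hef h ((ancL a ha hac).trans hcf)) hac
      · rw [hup c hc'] at hec hcf
        rcases Finset.mem_insert.1 hf with rfl | hf'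
        · rw [hux] at hcf
          obtain ⟨a, ha, hac, hca⟩ := memL c hc' hcf
          have hea : e ≠ a := by rintro rfl; exact absurd hec (not_lt.2 hca)
          have hanc : S.Anc e a := (S.anc_comparable hea hef hac).resolve_right fun h =>
            absurd (h1 e hex a ha h) (not_lt.2 (hec.le.trans hca))
          rcases hca.eq_or_lt with h | h
          · rwa [hinj hc' ha h]
          · exact h2 e hex c hc' a ha hanc hec h
        · rw [hup f hf'] at hcf
          exact h2 e hex c hc' f hf' hef hec hcf

/-- One chord closest to the center and all its descendants are put below the central face. -/
lemma exists_below [Finite ι] : ∃ B : ι → Prop, (∀ e f, S.Anc f e → (B f ↔ B e)) ∧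
    (∀ e s, B e → B s → (∀ g, ¬ S.Anc g e) → (∀ g, ¬ S.Anc g s) → e = s) ∧
    ∀ e s, ¬ B e → ¬ B s → ∃ g, (∀ k, ¬ S.Anc k g) ∧ S.d g ≤ S.d s ∧ g ≠ e ∧ g ≠ s := by
  rcases isEmpty_or_nonempty ι with hι | hι
  · exact ⟨fun _ => True, fun e => isEmptyElim e, fun e => isEmptyElim e, fun e => isEmptyElim e⟩
  obtain ⟨m, hm⟩ := Finite.exists_min S.d
  have htop : ∀ k, ¬ S.Anc k m := fun k h => (hm k).not_gt (S.d_lt_of_anc h)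
  refine ⟨fun e => e = m ∨ S.Anc m e, ?_, ?_, ?_⟩
  · intro e f hfe
    constructor
    · rintro (rfl | h)
      · exact Or.inr hfe
      · exact Or.inr (S.anc_trans h hfe)
    · rintro (rfl | h)
      · exact absurd hfe (htop f)
      · by_cases hfm : f = m
        · exact Or.inl hfm
        · exact Or.inr ((S.anc_comparable hfm hfe h).resolve_left (htop f))
  · rintro e s (rfl | he) (rfl | hs) h1 h2
    · rfl
    · exact absurd hs (h2 _)
    · exact absurd he (h1 _)
    · exact absurd he (h1 _)
  · intro e s he hs
    exact ⟨m, htop, hm s, fun h => he (Or.inl h.symm), fun h => hs (Or.inl h.symm)⟩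

/-- The heights of the faces, injective and such that a face strictly between the two faces
adjacent to the chord `e` is separated from `e` by a chord `s` with the same ancestors as `e`. If
there are no ancestors, then a third chord which is at least as long as `s` is available. -/
lemma exists_rank [Finite ι] (parent : ι → Option ι)
    (hparent : ∀ i j, j ∈ S.up (parent i) ↔ S.Anc j i) :
    ∃ R : Option ι → ℝ, Function.Injective R ∧ ∀ e c,
      (R (parent e) < R c ∧ R c < R (some e) ∨ R (some e) < R c ∧ R c < R (parent e)) →
      ∃ s, s ∈ S.up c ∧ s ≠ e ∧ ¬ S.Anc e s ∧ (∀ g, S.Anc g s ↔ S.Anc g e) ∧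
        ((∀ g, ¬ S.Anc g e) →
          ∃ g, (∀ k, ¬ S.Anc k g) ∧ S.d g ≤ S.d s ∧ g ≠ e ∧ g ≠ s) := by
  classical
  have := Fintype.ofFinite ι
  obtain ⟨r, hinj, h1, h2⟩ := S.exists_preorder Finset.univ
  obtain ⟨B, hB1, hB2, hB3⟩ := S.exists_below
  simp only [Finset.mem_univ, forall_true_left, Finset.coe_univ, Set.injOn_univ] at hinj h1 h2
  set R : Option ι → ℝ := fun a => a.elim 0 fun e => if B e then -Real.exp (r e) else Real.exp (r e)
    with hR
  have hRn : R none = 0 := rfl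
  have hRp : ∀ e, B e → R (some e) = -Real.exp (r e) := fun e he => by simp [hR, he]
  have hRm : ∀ e, ¬ B e → R (some e) = Real.exp (r e) := fun e he => by simp [hR, he]
  refine ⟨R, ?_, ?_⟩
  · rintro (_ | a) (_ | b) h
    · rfl
    · by_cases hb : B b
      · rw [hRn, hRp b hb] at h; linarith [Real.exp_pos (r b)]
      · rw [hRn, hRm b hb] at h; linarith [Real.exp_pos (r b)]
    · by_cases hb : B a
      · rw [hRn, hRp a hb] at h; linarith [Real.exp_pos (r a)]
      · rw [hRn, hRm a hb] at h; linarith [Real.exp_pos (r a)]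
    · have ea := Real.exp_pos (r a)
      have eb := Real.exp_pos (r b)
      have : Real.exp (r a) = Real.exp (r b) := by
        by_cases ha : B a <;> by_cases hb : B b
        · rw [hRp a ha, hRp b hb] at h; linarith
        · rw [hRp a ha, hRm b hb] at h; linarith
        · rw [hRm a ha, hRp b hb] at h; linarith
        · rwa [hRm a ha, hRm b hb] at h
      rw [hinj (Real.exp_injective this)]
  intro e c hc
  obtain ⟨c', rfl, hBc, hrc, hPc⟩ : ∃ c', c = some c' ∧ (B c' ↔ B e) ∧ r c' < r e ∧
      ∀ P, parent e = some P → r P < r c' := by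
    have ee := Real.exp_pos (r e)
    rcases hpe : parent e with _ | P
    · rw [hpe, hRn] at hc
      rcases c with _ | c'
      · rw [hRn] at hc
        rcases hc with hc | hc
        · exact absurd hc.1 (lt_irrefl _)
        · exact absurd hc.2 (lt_irrefl _)
      have ec := Real.exp_pos (r c')
      refine ⟨c', rfl, ?_, ?_, by simp⟩
      · by_cases he : B e <;> by_cases hc' : B c' <;>
          simp only [he, hc', hRp, hRm, not_false_eq_true] at hc ⊢
        · rcases hc with hc | hc <;> linarith
        · rcases hc with hc | hc <;> linarith
      · by_cases he : B e <;> by_cases hc' : B c' <;>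
          simp only [he, hc', hRp, hRm, not_false_eq_true] at hc <;>
          rw [← Real.exp_lt_exp] <;> rcases hc with hc | hc <;> linarith
    · have hPe : S.Anc P e := (hparent e P).1 (by rw [hpe]; exact Or.inl rfl)
      have hBP := hB1 e P hPe
      have eP := Real.exp_pos (r P)
      have hlt := Real.exp_lt_exp.2 (h1 e P hPe)
      rw [hpe] at hc
      rcases c with _ | c'
      · exfalso
        by_cases he : B e <;> by_cases hP : B P <;>
          simp only [he, hP, hRp, hRm, hRn, not_false_eq_true, iff_true, iff_false,
            not_true_eq_false] at hc hBP <;>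
          rcases hc with hc | hc <;> linarith
      have ec := Real.exp_pos (r c')
      refine ⟨c', rfl, ?_, ?_, ?_⟩
      · by_cases he : B e <;> by_cases hP : B P <;> by_cases hc' : B c' <;>
          simp only [he, hP, hc', hRp, hRm, not_false_eq_true, iff_true, iff_false,
            not_true_eq_false] at hc hBP ⊢ <;>
          rcases hc with hc | hc <;> linarith
      · by_cases he : B e <;> by_cases hP : B P <;> by_cases hc' : B c' <;>
          simp only [he, hP, hc', hRp, hRm, not_false_eq_true, iff_true, iff_false,
            not_true_eq_false] at hc hBP <;>
          rw [← Real.exp_lt_exp] <;> rcases hc with hc | hc <;> linarith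
      · rintro P' h
        obtain rfl := Option.some_injective _ h
        by_cases he : B e <;> by_cases hP : B P <;> by_cases hc' : B c' <;>
          simp only [he, hP, hc', hRp, hRm, not_false_eq_true, iff_true, iff_false,
            not_true_eq_false] at hc hBP <;>
          rw [← Real.exp_lt_exp] <;> rcases hc with hc | hc <;> linarith
  have hec : ¬ S.Anc e c' := fun h => lt_asymm hrc (h1 _ _ h)
  have hce : ¬ S.Anc c' e := fun h => by
    have h' := (hparent e c').2 h
    rcases hpe : parent e with _ | P
    · rw [hpe] at h'; exact h'
    · rw [hpe] at h'
      rcases h' with rfl | h'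
      · exact lt_irrefl _ (hPc _ hpe)
      · exact lt_asymm (hPc _ hpe) (h1 _ _ h')
  have hanc : ∀ g, S.Anc g e → S.Anc g c' := fun g h => by
    have h' := (hparent e g).2 h
    rcases hpe : parent e with _ | P
    · rw [hpe] at h'; exact h'.elim
    · have hPe : S.Anc P e := (hparent e P).1 (by rw [hpe]; exact Or.inl rfl)
      have hPc' := h2 P c' e hPe (hPc _ hpe) hrc
      rw [hpe] at h'
      rcases h' with rfl | h'
      · exact hPc'
      · exact S.anc_trans h' hPc'
  obtain ⟨s, ⟨hs1, hs2⟩, hmin⟩ := Set.exists_min_image {s | (s = c' ∨ S.Anc s c') ∧ ¬ S.Anc s e} S.d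
    (Set.toFinite _) ⟨c', Or.inl rfl, hce⟩
  have hse : s ≠ e := by
    rintro rfl
    rcases hs1 with rfl | h
    · exact lt_irrefl _ hrc
    · exact hec h
  have hes : ¬ S.Anc e s := fun h => by
    rcases hs1 with rfl | h'
    · exact hec h
    · exact hec (S.anc_trans h h')
  have hiff : ∀ g, S.Anc g s ↔ S.Anc g e := by
    refine fun g => ⟨fun h => ?_, fun h => ?_⟩
    · by_contra hn
      refine (hmin g ⟨Or.inr ?_, hn⟩).not_gt (S.d_lt_of_anc h)
      rcases hs1 with rfl | h'
      · exact h
      · exact S.anc_trans h h'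
    · rcases hs1 with rfl | h'
      · exact hanc g h
      · have hgs : g ≠ s := by rintro rfl; exact hs2 h
        exact (S.anc_comparable hgs (hanc g h) h').resolve_right fun h'' =>
          hs2 (S.anc_trans h'' h)
  refine ⟨s, hs1, hse, hes, hiff, fun htop => ?_⟩
  have htop' : ∀ g, ¬ S.Anc g s := fun g h => htop g ((hiff g).1 h)
  have hBs : B s ↔ B e := by
    rcases hs1 with rfl | h'
    · exact hBc
    · exact (hB1 _ _ h').trans hBc
  by_cases he : B e
  · exact absurd (hB2 s e (hBs.2 he) he htop' htop) hse
  · exact hB3 e s he fun h => he (hBs.1 h)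

end ChordSystem

/-- The values of a linear function at the two endpoints of a chord. -/
lemma exists_endpoints {n m : ℂ} (hn : ‖n‖ = 1) (hm : ‖m‖ = 1) {d : ℝ} (h0 : -1 < d) (h1 : d < 1) :
    (∃ u : ℂ, ‖u‖ = 1 ∧ lineFn n d u = 0 ∧ ∀ k, lineFn m k u =
      Real.cos (Real.arccos (n.re * m.re + n.im * m.im) - Real.arccos d) - k) ∧
    ∃ u : ℂ, ‖u‖ = 1 ∧ lineFn n d u = 0 ∧ ∀ k, lineFn m k u =
      Real.cos (Real.arccos (n.re * m.re + n.im * m.im) + Real.arccos d) - k := by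
  have hn2 : n.re ^ 2 + n.im ^ 2 = 1 := by rw [← norm_sq_coord, hn]; norm_num
  have hm2 : m.re ^ 2 + m.im ^ 2 = 1 := by rw [← norm_sq_coord, hm]; norm_num
  obtain ⟨hc, hs, hsc⟩ := arccos_sq h0 h1
  set σ := Real.arccos d
  set C := n.re * m.re + n.im * m.im with hC
  set D := n.re * m.im - n.im * m.re with hD
  have hCD : C ^ 2 + D ^ 2 = 1 := by
    rw [hC, hD]; linear_combination (m.re ^ 2 + m.im ^ 2) * hn2 + hm2
  have hC1 : -1 ≤ C := by nlinarith [sq_nonneg D]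
  have hC2 : C ≤ 1 := by nlinarith [sq_nonneg D]
  have hcos : Real.cos (Real.arccos C) = C := Real.cos_arccos hC1 hC2
  have hsin : Real.sin (Real.arccos C) = |D| := by
    rw [Real.sin_arccos, show 1 - C ^ 2 = D ^ 2 by linarith, Real.sqrt_sq_eq_abs]
  have pt : ∀ τ : ℝ, τ ^ 2 = Real.sin σ ^ 2 → ‖n * ⟨d, τ⟩‖ = 1 ∧ lineFn n d (n * ⟨d, τ⟩) = 0 ∧
      ∀ k, lineFn m k (n * ⟨d, τ⟩) = C * d + D * τ - k := by
    intro τ hτ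
    refine ⟨?_, ?_, fun k => ?_⟩
    · rw [norm_mul, hn, one_mul, ← pow_left_inj₀ (norm_nonneg _) zero_le_one two_ne_zero,
        norm_sq_coord]
      simp [hτ, hsc]
    · simp [lineFn]; linear_combination d * hn2
    · simp [lineFn, hC, hD]; ring
  rw [Real.cos_sub, Real.cos_add, hcos, hsin, hc]
  rcases abs_choice D with hD' | hD' <;> rw [hD']
  · refine ⟨⟨_, (pt (Real.sin σ) rfl).1, (pt _ rfl).2.1, fun k => ?_⟩,
      ⟨_, (pt (-Real.sin σ) (by ring)).1, (pt _ (by ring)).2.1, fun k => ?_⟩⟩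
    · rw [(pt _ rfl).2.2]
    · rw [(pt _ (by ring)).2.2]; ring
  · refine ⟨⟨_, (pt (-Real.sin σ) (by ring)).1, (pt _ (by ring)).2.1, fun k => ?_⟩,
      ⟨_, (pt (Real.sin σ) rfl).1, (pt _ rfl).2.1, fun k => ?_⟩⟩
    · rw [(pt _ (by ring)).2.2]; ring
    · rw [(pt _ rfl).2.2]; ring

namespace ChordSystem

variable {ι : Type*} (S : ChordSystem ι)

lemma dot_le_one (i j : ι) : (S.n i).re * (S.n j).re + (S.n i).im * (S.n j).im ≤ 1 := by
  nlinarith [S.n_sq i, S.n_sq j, sq_nonneg ((S.n i).re - (S.n j).re),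
    sq_nonneg ((S.n i).im - (S.n j).im)]

lemma capsSeparated_of_not_anc {i j : ι} (hij : i ≠ j) (h1 : ¬ S.Anc i j) (h2 : ¬ S.Anc j i) :
    CapsSeparated (S.n i) (S.d i) (S.n j) (S.d j) := by
  have hi0 : -1 < S.d i := by linarith [S.d_nonneg i]
  have hj0 : -1 < S.d j := by linarith [S.d_nonneg j]
  obtain ⟨⟨u, hu, hu0, hu1⟩, -⟩ := exists_endpoints (S.norm_n i) (S.norm_n j) hi0 (S.d_lt_one i)
  obtain ⟨⟨v, hv, hv0, hv1⟩, -⟩ := exists_endpoints (S.norm_n j) (S.norm_n i) hj0 (S.d_lt_one j)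
  have hu2 := S.nonpos_of_not_anc h2 (x := u) ⟨hu.le, hu0⟩
  have hv2 := S.nonpos_of_not_anc h1 (x := v) ⟨hv.le, hv0⟩
  rw [ℓ, hu1] at hu2
  rw [ℓ, hv1, mul_comm (S.n j).re, mul_comm (S.n j).im] at hv2
  have hci := (arccos_sq hi0 (S.d_lt_one i)).1
  have hcj := (arccos_sq hj0 (S.d_lt_one j)).1
  unfold CapsSeparated
  have hmid := S.ℓ_mid_ne hij
  rw [ℓ_mid] at hmid
  set C := (S.n i).re * (S.n j).re + (S.n i).im * (S.n j).im with hC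
  have hδ0 := Real.arccos_nonneg C
  have hδπ := Real.arccos_le_pi C
  have key : ∀ (a b d : ℝ), Real.cos (Real.arccos d) = d →
      Real.cos (a - b) - d ≤ 0 → Real.arccos d ≤ |a - b| := by
    intro a b d hd h
    by_contra! hlt
    have := Real.cos_lt_cos_of_nonneg_of_le_pi (abs_nonneg _) (Real.arccos_le_pi _) hlt
    rw [Real.cos_abs, hd] at this
    linarith
  have k1 := key _ _ _ hcj hu2
  have k2 := key _ _ _ hci hv2
  by_contra! hlt
  have hi' := Real.arccos_nonneg (S.d i)
  have hj' := Real.arccos_nonneg (S.d j)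
  have hz : Real.arccos C = 0 ∧ Real.arccos (S.d i) = Real.arccos (S.d j) := by
    rcases le_total 0 (Real.arccos C - Real.arccos (S.d i)) with h | h
    · rw [abs_of_nonneg h] at k1; linarith
    · rw [abs_of_nonpos h] at k1
      rcases le_total 0 (Real.arccos C - Real.arccos (S.d j)) with h' | h'
      · rw [abs_of_nonneg h'] at k2; linarith
      · rw [abs_of_nonpos h'] at k2; constructor <;> linarith
  have hC1 : C = 1 := le_antisymm (S.dot_le_one i j) (Real.arccos_eq_zero.1 hz.1)
  have hd : S.d i = S.d j := by rw [← hci, ← hcj, hz.2]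
  rw [hC1, hd] at hmid
  exact hmid (by ring)

lemma capsSeparated_of_anc {i j : ι} (h : S.Anc i j) :
    CapsSeparated (S.n j) (S.d j) (-S.n i) (-S.d i) := by
  have hi0 : -1 < S.d i := by linarith [S.d_nonneg i]
  have hj0 : -1 < S.d j := by linarith [S.d_nonneg j]
  obtain ⟨-, u, hu, hu0, hu1⟩ := exists_endpoints (S.norm_n j) (S.norm_n i) hj0 (S.d_lt_one j)
  have hu2 := S.nonneg_of_anc h (x := u) ⟨hu.le, hu0⟩
  rw [ℓ, hu1] at hu2
  have hci := (arccos_sq hi0 (S.d_lt_one i)).1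
  have h' := h
  rw [Anc, ℓ_mid, mul_comm (S.n i).re, mul_comm (S.n i).im] at h'
  unfold CapsSeparated
  simp only [Complex.neg_re, Complex.neg_im, mul_neg]
  rw [show ∀ a b : ℝ, -a + -b = -(a + b) by intros; ring, Real.arccos_neg, Real.arccos_neg]
  set C := (S.n j).re * (S.n i).re + (S.n j).im * (S.n i).im with hC
  have hCpos : 0 ≤ C := by
    by_contra! hneg
    nlinarith [S.d_nonneg i, S.d_nonneg j]
  have a1 := Real.arccos_le_pi_div_two.2 hCpos
  have a2 := Real.arccos_le_pi_div_two.2 (S.d_nonneg j)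
  by_contra! hlt
  have := Real.cos_lt_cos_of_nonneg_of_le_pi (Real.arccos_nonneg (S.d i))
    (show Real.arccos C + Real.arccos (S.d j) ≤ Real.pi by linarith) (by linarith)
  linarith

/-- A point in the cap of `s` cannot be folded onto a different point of the chord `e` if `s` and
`e` bound the same face and this face has a suitable third side. -/
lemma eq_of_fold_eq [Finite ι] {φ : ℂ → ℂ} {a : Option ι}
    (hlip : ∀ x y : ℂ, ‖x‖ ≤ 1 → ‖y‖ ≤ 1 → dist (φ x) (φ y) ≤ dist x y)
    (hface : ∀ x ∈ S.face a, ∀ y ∈ S.face a, dist (φ x) (φ y) = dist x y)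
    {s e : ι} (ha : ∀ j, j ∈ S.up a ↔ S.Anc j e)
    (hse : s ≠ e) (hes : ¬ S.Anc e s) (hanc : ∀ g, S.Anc g s ↔ S.Anc g e)
    (htop : (∀ g, ¬ S.Anc g e) → ∃ g, (∀ k, ¬ S.Anc k g) ∧ S.d g ≤ S.d s ∧ g ≠ e ∧ g ≠ s)
    {p y : ℂ} (hp : ‖p‖ ≤ 1) (hps : 0 ≤ S.ℓ s p) (hy : y ∈ S.chord e) (hpy : φ p = φ y) :
    y = p := by
  have hse' : ¬ S.Anc s e := fun h => S.anc_irrefl s ((hanc s).2 h)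
  have s12 := S.capsSeparated_of_not_anc hse hse' hes
  obtain ⟨n₃, d₃, hn₃, hd₃, s13, s23⟩ : ∃ (n₃ : ℂ) (d₃ : ℝ), ‖n₃‖ = 1 ∧ d₃ ≤ S.d s ∧
      CapsSeparated (S.n s) (S.d s) n₃ d₃ ∧ CapsSeparated (S.n e) (S.d e) n₃ d₃ := by
    by_cases h : ∀ g, ¬ S.Anc g e
    · obtain ⟨g, hg, hgs, hge, hgs'⟩ := htop h
      refine ⟨S.n g, S.d g, S.norm_n g, hgs, ?_, ?_⟩
      · exact S.capsSeparated_of_not_anc hgs'.symm (hg s) fun h' => h g ((hanc g).1 h')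
      · exact S.capsSeparated_of_not_anc hge.symm (hg e) (h g)
    · push Not at h
      obtain ⟨P, hP⟩ := h
      refine ⟨-S.n P, -S.d P, by rw [norm_neg, S.norm_n], ?_, ?_, S.capsSeparated_of_anc hP⟩
      · linarith [S.d_nonneg P, S.d_nonneg s]
      · exact S.capsSeparated_of_anc ((hanc P).2 hP)
  obtain ⟨h, hh, hdh, h3⟩ := chord_beyond_tangent (S.norm_n s) (S.norm_n e) hn₃ (S.d_nonneg s)
    (S.d_lt_one s) (S.d_nonneg e) (S.d_lt_one e) hd₃ s12 s13 s23 hy.1 hy.2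
  have hya : y ∈ S.face a := S.chord_subset_face (fun j _ => ha j) hy
  have hend : ∀ k : ℝ, S.d s ^ 2 + k ^ 2 = 1 →
      dist y (S.n s * ⟨S.d s, k⟩) ≤ dist p (S.n s * ⟨S.d s, k⟩) := by
    intro k hk
    have hu : S.n s * ⟨S.d s, k⟩ ∈ S.chord s := by
      refine ⟨?_, ?_⟩
      · rw [norm_mul, S.norm_n, one_mul, ← pow_le_pow_iff_left₀ (norm_nonneg _) zero_le_one
          two_ne_zero, norm_sq_coord]
        simp [hk]
      · have := S.n_sq s
        simp [ℓ, lineFn]; linear_combination S.d s * this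
    have hua := S.chord_subset_face (fun j _ => (ha j).trans (hanc j).symm) hu
    rw [← hface y hya _ hua, ← hpy]
    exact hlip _ _ hp hu.1
  exact cap_contraction (S.norm_n s) (S.d_nonneg s) hh hdh hp hps (S.nonpos_of_not_anc hse' hy)
    (hend h hdh) (hend (-h) (by rw [neg_sq, hdh])) h3

end ChordSystem

/-- A map which is injective on each of finitely many closed faces becomes injective on their union
after adding a real coordinate, if the faces can be stacked in such a way that no face touches a
crease joining a lower and a higher face. -/
lemma exists_layering {X Y Φ ι : Type*} [TopologicalSpace X] [MetricSpace Y] [Finite Φ] [Nonempty Φ]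
    [Finite ι]
    {φ : X → Y} {K : Set X} (hφ : ContinuousOn φ K) {face : Φ → Set X}
    (hK : ∀ x, x ∈ K ↔ ∃ a, x ∈ face a) (hclosed : ∀ a, IsClosed (face a))
    (hinj : ∀ a, Set.InjOn φ (face a)) {R : Φ → ℝ} (hR : Function.Injective R)
    {Γ : ι → Set X} (hΓ : ∀ e, IsCompact (Γ e)) (hΓn : ∀ e, (Γ e).Nonempty) {lo hi : ι → Φ}
    (hlohi : ∀ e, R (lo e) < R (hi e)) (hlo : ∀ e, Γ e ⊆ face (lo e))
    (hhi : ∀ e, Γ e ⊆ face (hi e))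
    (hconn : ∀ p a b, p ∈ face a → p ∈ face b →
      Relation.EqvGen (fun a b => ∃ e, p ∈ Γ e ∧ a = lo e ∧ b = hi e) a b)
    (hbetween : ∀ e c, R (lo e) < R c → R c < R (hi e) → ∀ p ∈ face c, ∀ y ∈ Γ e,
      φ p = φ y → y = p) :
    ∃ H : X → ℝ, ContinuousOn H K ∧ ∀ p ∈ K, ∀ q ∈ K, φ p = φ q → H p = H q → p = q := by
  classical
  have := Fintype.ofFinite Φ
  have := Fintype.ofFinite ι
  have hsub : ∀ a, face a ⊆ K := fun a x hx => (hK x).2 ⟨a, hx⟩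
  set w : Φ → Y → ℝ := fun b x => ∏ e, if R (lo e) < R b ∧ R b ≤ R (hi e) then
    Metric.infDist x (φ '' Γ e) else 1 with hw
  have w_nonneg : ∀ b x, 0 ≤ w b x := fun b x => Finset.prod_nonneg fun e _ => by
    split_ifs
    · exact Metric.infDist_nonneg
    · exact zero_le_one
  have w_cont : ∀ b, Continuous (w b) := fun b => continuous_finsetProd _ fun e _ => by
    split_ifs
    · exact Metric.continuous_infDist_pt _
    · exact continuous_const
  set g : Φ → Y → ℝ := fun a x => ∑ b, if R b ≤ R a then w b x else 0 with hg
  have g_cont : ∀ a, Continuous (g a) := fun a => continuous_finsetSum _ fun b _ => by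
    split_ifs
    · exact w_cont b
    · exact continuous_const
  have w_zero : ∀ e, ∀ y ∈ Γ e, ∀ b, R (lo e) < R b → R b ≤ R (hi e) → w b (φ y) = 0 := by
    intro e y hy b h1 h2
    refine Finset.prod_eq_zero (Finset.mem_univ e) ?_
    rw [if_pos ⟨h1, h2⟩]
    exact Metric.infDist_zero_of_mem (Set.mem_image_of_mem _ hy)
  have g_cross : ∀ e, ∀ y ∈ Γ e, g (lo e) (φ y) = g (hi e) (φ y) := by
    intro e y hy
    refine Finset.sum_congr rfl fun b _ => ?_
    by_cases h1 : R b ≤ R (lo e)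
    · rw [if_pos h1, if_pos (h1.trans (hlohi e).le)]
    · by_cases h2 : R b ≤ R (hi e)
      · rw [if_neg h1, if_pos h2, w_zero e y hy b (not_le.1 h1) h2]
      · rw [if_neg h1, if_neg h2]
  have g_eq : ∀ p a b, p ∈ face a → p ∈ face b → g a (φ p) = g b (φ p) := by
    intro p a b ha hb
    have h := hconn p a b ha hb
    clear ha hb
    induction h with
    | rel _ _ h =>
      obtain ⟨e, he, rfl, rfl⟩ := h
      exact g_cross e p he
    | refl _ => rfl
    | symm _ _ _ ih => exact ih.symm
    | trans _ _ _ _ _ ih1 ih2 => exact ih1.trans ih2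
  choose! a₀ ha₀ using fun x => (hK x).1
  set H : X → ℝ := fun p => g (a₀ p) (φ p) with hH
  have H_eq : ∀ p a, p ∈ face a → H p = g a (φ p) := fun p a ha =>
    g_eq p _ _ (ha₀ p (hsub a ha)) ha
  have main : ∀ a b p q, p ∈ face a → q ∈ face b → R a ≤ R b → φ p = φ q → H p = H q → p = q := by
    intro a' b p q hpa' hq hab' hpq hHpq
    obtain ⟨a, ⟨hpa, hab⟩, hmax⟩ := Set.exists_max_image {a | p ∈ face a ∧ R a ≤ R b} R
      (Set.toFinite _) ⟨a', hpa', hab'⟩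
    rcases hab.eq_or_lt with h | hlt
    · obtain rfl := hR h
      exact hinj a hpa hq hpq
    rw [H_eq p a hpa, H_eq q b hq, ← hpq] at hHpq
    obtain ⟨c, hac, hmin⟩ := Set.exists_min_image {c | R a < R c} R (Set.toFinite _) ⟨b, hlt⟩
    have hcb : R c ≤ R b := hmin b hlt
    have hwc : w c (φ p) = 0 := by
      have := (Finset.sum_eq_sum_iff_of_le (fun i _ => by
        by_cases h1 : R i ≤ R a
        · rw [if_pos h1, if_pos (h1.trans hab)]
        · rw [if_neg h1]
          split_ifs
          · exact w_nonneg _ _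
          · exact le_rfl)).1 hHpq c (Finset.mem_univ c)
      rw [if_neg (not_le.2 hac), if_pos hcb] at this
      exact this.symm
    obtain ⟨e, -, he⟩ := Finset.prod_eq_zero_iff.1 hwc
    have hce : R (lo e) < R c ∧ R c ≤ R (hi e) := by
      by_contra h
      rw [if_neg h] at he
      exact one_ne_zero he
    rw [if_pos hce] at he
    obtain ⟨y, hy, hyx⟩ : φ p ∈ φ '' Γ e := by
      rwa [(((hΓ e).image_of_continuousOn
        (hφ.mono ((hlo e).trans (hsub _)))).isClosed).mem_iff_infDist_zero ((hΓn e).image φ)]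
    have hloa : R (lo e) ≤ R a := by
      by_contra! h
      exact hce.1.not_ge (hmin _ h)
    have hyp : y = p := by
      rcases hloa.eq_or_lt with h | h
      · have h' := hlo e hy
        rw [hR h] at h'
        exact hinj a h' hpa hyx
      · exact hbetween e a h (lt_of_lt_of_le hac hce.2) p hpa y hy hyx.symm
    have hbhi : R b < R (hi e) := by
      by_contra! h
      exact (lt_of_lt_of_le hac hce.2).not_ge (hmax (hi e) ⟨hyp ▸ hhi e hy, h⟩)
    rw [← hyp]
    exact hbetween e b (hloa.trans_lt hlt) hbhi q hq y hy (by rw [hyx, hpq])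
  refine ⟨H, ?_, ?_⟩
  · have hU : K = ⋃ a, face a := by ext x; simp [hK]
    rw [hU]
    refine (locallyFinite_of_finite face).continuousOn_iUnion hclosed fun a => ?_
    exact ((g_cont a).comp_continuousOn (hφ.mono (hsub a))).congr fun p hp => H_eq p a hp
  · intro p hp q hq hpq hHpq
    obtain ⟨a, ha⟩ := (hK p).1 hp
    obtain ⟨b, hb⟩ := (hK q).1 hq
    rcases le_total (R a) (R b) with h | h
    · exact main a b p q ha hb h hpq hHpq
    · exact (main b a q p hb ha h hpq.symm hHpq.symm).symm

/-- A folding of the unit disk along a system of chords can be layered. -/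
theorem ChordSystem.exists_height {ι : Type*} [Finite ι] (S : ChordSystem ι) {φ : ℂ → ℂ}
    (hlip : ∀ x y : ℂ, ‖x‖ ≤ 1 → ‖y‖ ≤ 1 → dist (φ x) (φ y) ≤ dist x y)
    (hiso : ∀ x y : ℂ, ‖x‖ < 1 → ‖y‖ < 1 →
      (∀ i, (0 < S.ℓ i x ∧ 0 < S.ℓ i y) ∨ (S.ℓ i x < 0 ∧ S.ℓ i y < 0)) →
      dist (φ x) (φ y) = dist x y) :
    ∃ H : ℂ → ℝ, ContinuousOn H (Metric.closedBall 0 1) ∧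
      ∀ p q : ℂ, ‖p‖ ≤ 1 → ‖q‖ ≤ 1 → φ p = φ q → H p = H q → p = q := by
  classical
  have hφ : ContinuousOn φ (Metric.closedBall 0 1) := by
    refine LipschitzOnWith.continuousOn (K := 1) (LipschitzOnWith.of_dist_le_mul ?_)
    intro x hx y hy
    rw [mem_closedBall_zero_iff] at hx hy
    simpa using hlip x y hx hy
  have hface : ∀ a, ∀ x ∈ S.face a, ∀ y ∈ S.face a, dist (φ x) (φ y) = dist x y :=
    fun a x hx y hy => S.dist_eq_of_mem_face hφ hiso hx hy
  choose parent hparent using S.exists_parent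
  obtain ⟨R, hR, hbet⟩ := S.exists_rank parent hparent
  have hne : ∀ e, R (parent e) ≠ R (some e) := fun e h => by
    have := (hparent e e).1 (by rw [hR h]; exact Or.inl rfl)
    exact S.anc_irrefl e this
  set up : ι → Prop := fun e => R (parent e) < R (some e)
  have hparentface : ∀ e, S.chord e ⊆ S.face (parent e) := fun e =>
    S.chord_subset_face fun j _ => hparent e j
  obtain ⟨H, hH, hinj⟩ := exists_layering (φ := φ) (K := Metric.closedBall 0 1) hφ (face := S.face)
    (fun x => ⟨fun hx => S.exists_mem_face (mem_closedBall_zero_iff.1 hx),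
      fun ⟨a, ha⟩ => mem_closedBall_zero_iff.2 ha.1⟩) S.isClosed_face
    (fun a x hx y hy h => dist_eq_zero.1 (by rw [← hface a x hx y hy, h, dist_self])) hR
    (Γ := S.chord) S.isCompact_chord (fun e => ⟨_, S.mid_mem_chord e⟩)
    (lo := fun e => if up e then parent e else some e)
    (hi := fun e => if up e then some e else parent e)
    (fun e => by
      by_cases h : up e
      · simpa only [if_pos h] using h
      · simpa only [if_neg h] using lt_of_le_of_ne (not_lt.1 h) (hne e).symm)
    (fun e => by
      by_cases h : up e
      · simpa only [if_pos h] using hparentface e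
      · simpa only [if_neg h] using S.chord_subset_face_some e)
    (fun e => by
      by_cases h : up e
      · simpa only [if_pos h] using S.chord_subset_face_some e
      · simpa only [if_neg h] using hparentface e)
    (fun p a b ha hb => by
      refine Relation.EqvGen.rec ?_ ?_ ?_ ?_ (S.eqvGen_of_mem_face parent hparent ha hb)
      · rintro _ _ ⟨e, he, rfl, rfl⟩
        by_cases h : up e
        · exact (Relation.EqvGen.rel _ _
            ⟨e, he, by simp only [if_pos h], by simp only [if_pos h]⟩).symm
        · exact Relation.EqvGen.rel _ _
            ⟨e, he, by simp only [if_neg h], by simp only [if_neg h]⟩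
      · exact fun x => Relation.EqvGen.refl x
      · exact fun x y _ h => h.symm
      · exact fun x y z _ _ h h' => h.trans _ _ _ h')
    (fun e c h1 h2 p hp y hy hpy => by
      obtain ⟨s, hsc, hse, hes, hanc, htop⟩ := hbet e c (by
        by_cases h : up e
        · simp only [if_pos h] at h1 h2
          exact Or.inl ⟨h1, h2⟩
        · simp only [if_neg h] at h1 h2
          exact Or.inr ⟨h1, h2⟩)
      exact S.eq_of_fold_eq hlip (hface _) (hparent e) hse hes hanc htop hp.1 (hp.2.1 s hsc) hy hpy)
  exact ⟨H, hH, fun p q hp hq => hinj p (mem_closedBall_zero_iff.2 hp) q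
    (mem_closedBall_zero_iff.2 hq)⟩

open Filter Topology in
lemma exists_pos_of_eventually {P : ℂ → Prop} {x : ℂ} (h : ∀ᶠ y in 𝓝 x, P y) (w : ℂ) :
    ∃ t : ℝ, 0 < t ∧ P (x + t * w) := by
  have hc : Continuous fun t : ℝ => x + t * w := by fun_prop
  have h' : Tendsto (fun t : ℝ => x + t * w) (𝓝[>] 0) (𝓝 x) := by
    have := hc.tendsto 0
    simp only [Complex.ofReal_zero, zero_mul, add_zero] at this
    exact this.mono_left nhdsWithin_le_nhds
  obtain ⟨t, ht, ht0⟩ := ((h'.eventually h).and self_mem_nhdsWithin).exists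
  exact ⟨t, ht0, ht⟩

lemma isometryEquiv_eq_of_eqOn {f g : ℂ ≃ᵢ ℂ} {s : Set ℂ} (hs : IsOpen s) (hne : s.Nonempty)
    (h : Set.EqOn f g s) : f = g := by
  have h1 := AffineMap.ext_on (f := f.toRealAffineIsometryEquiv.toAffineEquiv.toAffineMap)
    (g := g.toRealAffineIsometryEquiv.toAffineEquiv.toAffineMap) (hs.affineSpan_eq_top hne)
    (fun x hx => by simpa using h hx)
  ext x
  simpa using DFunLike.congr_fun h1 x

/-- The side of the vector `v` with respect to the line spanned by `d`. -/
def side (d v : ℂ) : ℝ := (v * starRingEnd ℂ d).im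

lemma side_eq (d v : ℂ) : side d v = v.im * d.re - v.re * d.im := by
  simp [side]; ring

lemma continuous_side (d x : ℂ) : Continuous fun y => side d (y - x) := by
  simp only [side_eq]; fun_prop

lemma side_mul_self (d : ℂ) (t : ℝ) : side d (t * (Complex.I * d)) = t * ‖d‖ ^ 2 := by
  rw [side_eq, norm_sq_coord]; simp; ring

lemma exists_smul_of_side_eq_zero {d d' : ℂ} (hd : d ≠ 0) (hd' : d' ≠ 0) (h : side d' d = 0) :
    ∃ r : ℝ, r ≠ 0 ∧ d' = r * d := by
  have hn : d.re ^ 2 + d.im ^ 2 ≠ 0 := by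
    rw [← norm_sq_coord]; exact pow_ne_zero 2 (norm_ne_zero_iff.2 hd)
  rw [side_eq] at h
  have e : d' = ((d'.re * d.re + d'.im * d.im) / (d.re ^ 2 + d.im ^ 2) : ℝ) * d := by
    apply Complex.ext
    · simp only [Complex.mul_re, Complex.ofReal_re, Complex.ofReal_im]
      field_simp
      linear_combination d.im * h
    · simp only [Complex.mul_im, Complex.ofReal_re, Complex.ofReal_im]
      field_simp
      linear_combination -d.re * h
  refine ⟨_, fun h0 => hd' ?_, e⟩
  rw [e, h0]; simp

open Topology in
lemma isometryEquiv_eq_of_side {f g : ℂ ≃ᵢ ℂ} {x d : ℂ} (hd : d ≠ 0)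
    (h : ∀ᶠ y in 𝓝 x, 0 ≤ side d (y - x) → f y = g y) : f = g := by
  obtain ⟨s, hs, hso, hxs⟩ := eventually_nhds_iff.1 h
  obtain ⟨t, ht, hts⟩ := exists_pos_of_eventually (hso.mem_nhds hxs) (Complex.I * d)
  refine isometryEquiv_eq_of_eqOn
    (hso.inter (isOpen_lt continuous_const (continuous_side d x))) ⟨_, hts, ?_⟩
    fun y hy => hs y hy.1 (le_of_lt hy.2)
  have : 0 < t * ‖d‖ ^ 2 := mul_pos ht (pow_pos (norm_pos_iff.2 hd) 2)
  simpa [side_mul_self] using this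

open Topology in
/-- `φ` agrees with an isometry near `x`. -/
def FlatAt (φ : ℂ → ℂ) (x : ℂ) : Prop := ∃ f : ℂ ≃ᵢ ℂ, ∀ᶠ y in 𝓝 x, φ y = f y

open Topology in
/-- `φ` is folded at `x` along the line with direction `d`. -/
def FoldedAt (φ : ℂ → ℂ) (x d : ℂ) : Prop :=
  d ≠ 0 ∧ ∃ f₁ f₂ : ℂ ≃ᵢ ℂ, f₁ ≠ f₂ ∧
    ∀ᶠ y in 𝓝 x, (0 ≤ side d (y - x) → φ y = f₁ y) ∧ (side d (y - x) ≤ 0 → φ y = f₂ y)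

lemma FlatAt.not_foldedAt {φ : ℂ → ℂ} {x d : ℂ} (h : FlatAt φ x) : ¬ FoldedAt φ x d := by
  rintro ⟨hd, f₁, f₂, hne, hf⟩
  obtain ⟨f, h⟩ := h
  have h1 : f = f₁ := isometryEquiv_eq_of_side (x := x) hd (by
    filter_upwards [h, hf] with y hy hfy h0
    rw [← hy, hfy.1 h0])
  have h2 : f = f₂ := isometryEquiv_eq_of_side (x := x) (neg_ne_zero.2 hd) (by
    filter_upwards [h, hf] with y hy hfy h0
    rw [← hy, hfy.2 (by rw [side_eq] at h0 ⊢; simp at h0 ⊢; linarith)])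
  exact hne (h1.symm.trans h2)

open Topology in
lemma FlatAt.eventually {φ : ℂ → ℂ} {x : ℂ} (h : FlatAt φ x) : ∀ᶠ y in 𝓝 x, FlatAt φ y := by
  obtain ⟨f, h⟩ := h
  filter_upwards [eventually_eventually_nhds.2 h] with y hy using ⟨f, hy⟩

open Topology in
lemma FoldedAt.eventually {φ : ℂ → ℂ} {x d : ℂ} (h : FoldedAt φ x d) :
    ∀ᶠ y in 𝓝 x, (side d (y - x) = 0 → FoldedAt φ y d) ∧ (side d (y - x) ≠ 0 → FlatAt φ y) := by
  obtain ⟨hd, f₁, f₂, hne, hf⟩ := h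
  filter_upwards [eventually_eventually_nhds.2 hf] with y hy
  refine ⟨fun h0 => ⟨hd, f₁, f₂, hne, ?_⟩, fun h0 => ?_⟩
  · filter_upwards [hy] with z hz
    have : side d (z - x) = side d (z - y) := by
      simp only [side_eq, Complex.sub_re, Complex.sub_im] at h0 ⊢
      linarith
    rwa [this] at hz
  · rcases lt_or_gt_of_ne h0 with h | h
    · refine ⟨f₂, ?_⟩
      filter_upwards [hy, (continuous_side d x).continuousAt.eventually_lt continuousAt_const h]
        with z hz hz0 using hz.2 hz0.le
    · refine ⟨f₁, ?_⟩
      filter_upwards [hy, continuousAt_const.eventually_lt (continuous_side d x).continuousAt h]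
        with z hz hz0 using hz.1 hz0.le

lemma FoldedAt.congr {φ : ℂ → ℂ} {x d d' : ℂ} (h : FoldedAt φ x d) (hd' : d' ≠ 0)
    (hs : side d' d = 0) : FoldedAt φ x d' := by
  obtain ⟨hd, f₁, f₂, hne, hf⟩ := h
  obtain ⟨r, hr, rfl⟩ := exists_smul_of_side_eq_zero hd hd' hs
  have e : ∀ v, side (r * d) v = r * side d v := fun v => by simp [side_eq]; ring
  rcases lt_or_gt_of_ne hr with hr | hr
  · refine ⟨hd', f₂, f₁, hne.symm, ?_⟩
    filter_upwards [hf] with y hy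
    rw [e]
    exact ⟨fun h => hy.2 (nonpos_of_mul_nonneg_right h hr),
      fun h => hy.1 (nonneg_of_mul_nonpos_right h hr)⟩
  · refine ⟨hd', f₁, f₂, hne, ?_⟩
    filter_upwards [hf] with y hy
    rw [e]
    exact ⟨fun h => hy.1 (nonneg_of_mul_nonneg_right h hr),
      fun h => hy.2 (nonpos_of_mul_nonpos_right h hr)⟩

lemma FoldedAt.parallel {φ : ℂ → ℂ} {x d d' : ℂ} (h : FoldedAt φ x d) (h' : FoldedAt φ x d') :
    side d' d = 0 := by
  by_contra hne
  obtain ⟨t, ht, h1, h2⟩ := exists_pos_of_eventually (h.eventually.and h'.eventually) d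
  refine (h2.2 ?_).not_foldedAt (h1.1 ?_)
  · have : side d' (x + t * d - x) = t * side d' d := by simp [side_eq]; ring
    rw [this]; exact mul_ne_zero ht.ne' hne
  · simp [side_eq]; ring

open Topology in
/-- Creases extend along straight lines. -/
lemma FoldedAt.of_side_eq_zero {φ : ℂ → ℂ} {B : Set ℂ} (hB : Convex ℝ B)
    (h : ∀ x ∈ B, FlatAt φ x ∨ ∃ d, FoldedAt φ x d) {x y d : ℂ} (hx : x ∈ B) (hy : y ∈ B)
    (hxd : FoldedAt φ x d) (hxy : side d (y - x) = 0) : FoldedAt φ y d := by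
  set L := B ∩ {z | side d (z - x) = 0} with hL
  have hLc : IsPreconnected L := by
    refine Convex.isPreconnected (hB.inter fun u hu v hv a b _ _ hab => ?_)
    simp only [Set.mem_ofPred_eq, side_eq] at hu hv ⊢
    simp only [Complex.sub_re, Complex.sub_im, Complex.add_re, Complex.add_im, Complex.real_smul,
      Complex.mul_re, Complex.mul_im, Complex.ofReal_re, Complex.ofReal_im] at hu hv ⊢
    linear_combination a * hu + b * hv + (d.re * x.im - d.im * x.re) * hab
  have sub : ∀ u ∈ L, ∀ v ∈ L, ∀ d', side d' d = 0 → side d' (u - v) = 0 := by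
    intro u hu v hv d' hd'
    have h1 : side d (u - x) = 0 := hu.2
    have h2 : side d (v - x) = 0 := hv.2
    by_cases h0 : d' = 0
    · simp [side_eq, h0]
    obtain ⟨r, -, rfl⟩ := exists_smul_of_side_eq_zero hxd.1 h0 hd'
    simp only [side_eq, Complex.sub_re, Complex.sub_im] at h1 h2 ⊢
    simp
    linear_combination r * (h1 - h2)
  refine (hLc.induction₂ (fun u v => FoldedAt φ u d ↔ FoldedAt φ v d) ?_
    (fun _ _ _ _ _ _ => Iff.trans) (fun _ _ _ _ => Iff.symm) (⟨hx, by simp [side_eq]⟩ : x ∈ L)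
    (⟨hy, hxy⟩ : y ∈ L)).1 hxd
  intro u hu
  rcases h u hu.1 with hf | ⟨d', hd'⟩
  · filter_upwards [nhdsWithin_le_nhds hf.eventually] with v hv
    exact iff_of_false hf.not_foldedAt hv.not_foldedAt
  by_cases hs : side d' d = 0
  · have hs' : side d d' = 0 := by rw [side_eq] at hs ⊢; linarith
    have hud := hd'.congr hxd.1 hs'
    filter_upwards [nhdsWithin_le_nhds hud.eventually, self_mem_nhdsWithin] with v hv hvL
    exact iff_of_true hud (hv.1 (sub v hvL u hu d (by rw [side_eq]; ring)))
  · have hnu : ¬ FoldedAt φ u d := fun hud => hs (hud.parallel hd')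
    filter_upwards [nhdsWithin_le_nhds hd'.eventually, self_mem_nhdsWithin] with v hv hvL
    rcases eq_or_ne v u with rfl | hvu
    · exact Iff.rfl
    refine iff_of_false hnu (hv.2 fun h0 => hs ?_).not_foldedAt
    have h1 := sub v hvL u hu d (by rw [side_eq]; ring)
    obtain ⟨r, hr, he⟩ := exists_smul_of_side_eq_zero (sub_ne_zero.2 hvu) hxd.1 h1
    rw [he]
    have : side d' (r * (v - u)) = r * side d' (v - u) := by simp [side_eq]; ring
    rw [this, h0, mul_zero]

open Topology in
/-- Two points which can be joined avoiding the creases are moved by the same isometry. -/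
lemma dist_eq_of_flatAt {φ : ℂ → ℂ} {s : Set ℂ} (hs : IsPreconnected s) (h : ∀ x ∈ s, FlatAt φ x)
    {x y : ℂ} (hx : x ∈ s) (hy : y ∈ s) : dist (φ x) (φ y) = dist x y := by
  obtain ⟨f, hfx, hfy⟩ := hs.induction₂
    (fun x y => ∃ f : ℂ ≃ᵢ ℂ, (∀ᶠ z in 𝓝 x, φ z = f z) ∧ ∀ᶠ z in 𝓝 y, φ z = f z)
    (fun x hx => by
      obtain ⟨f, hf⟩ := h x hx
      filter_upwards [nhdsWithin_le_nhds (eventually_eventually_nhds.2 hf)] with y hy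
      exact ⟨f, hf, hy⟩)
    (fun x y z _ _ _ ⟨f, hf, hf'⟩ ⟨g, hg, hg'⟩ => by
      have : f = g := isometryEquiv_eq_of_side (x := y) (d := 1) one_ne_zero (by
        filter_upwards [hf', hg] with z h1 h2 _
        rw [← h1, ← h2])
      exact ⟨f, hf, this ▸ hg'⟩)
    (fun x y _ _ ⟨f, hf, hf'⟩ => ⟨f, hf', hf⟩) hx hy
  rw [hfx.self_of_nhds, hfy.self_of_nhds, f.dist_eq]

open Topology in
lemma dist_le_of_local {φ : ℂ → ℂ} {K : Set ℂ} (hK : Convex ℝ K)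
    (h : ∀ x ∈ K, ∀ᶠ y in 𝓝[K] x, dist (φ y) (φ x) = dist y x) {x y : ℂ} (hx : x ∈ K)
    (hy : y ∈ K) : dist (φ x) (φ y) ≤ dist x y := by
  set γ : ℝ → ℂ := fun t => x + t * (y - x) with hγ
  have hγK : ∀ t ∈ Icc (0 : ℝ) 1, γ t ∈ K := fun t ht => by
    simpa [hγ] using hK.add_smul_sub_mem hx hy ht
  have hγc : Continuous γ := by fun_prop
  have hdist : ∀ s t, dist (γ s) (γ t) = |s - t| * dist x y := fun s t => by
    rw [dist_eq_norm, dist_comm x y, dist_eq_norm, ← Real.norm_eq_abs, ← Complex.norm_real,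
      ← norm_mul]
    congr 1
    simp [hγ]; ring
  have hcont : ContinuousOn φ K := fun z hz => by
    rw [ContinuousWithinAt, tendsto_iff_dist_tendsto_zero]
    refine Filter.Tendsto.congr' (f₁ := fun w => dist w z) ?_ ?_
    · filter_upwards [h z hz] with w hw using hw.symm
    · exact tendsto_iff_dist_tendsto_zero.1 (Filter.tendsto_id.mono_left nhdsWithin_le_nhds)
  set s := {t : ℝ | dist (φ (γ t)) (φ x) ≤ t * dist x y} with hs
  have hclosed : IsClosed (s ∩ Icc 0 1) := by
    have : s ∩ Icc 0 1 = {t ∈ Icc (0 : ℝ) 1 | dist (φ (γ t)) (φ x) ≤ t * dist x y} := by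
      ext t; simp [hs, and_comm]
    rw [this]
    refine isClosed_Icc.isClosed_le ?_ (by fun_prop)
    exact (continuous_id.dist continuous_const).comp_continuousOn
      (hcont.comp hγc.continuousOn hγK)
  have h1 : (1 : ℝ) ∈ s := by
    refine hclosed.Icc_subset_of_forall_exists_gt (by simp [hs, hγ]) ?_
      (right_mem_Icc.2 zero_le_one)
    rintro t ⟨hts, ht0, ht1⟩ u hu
    have htend : Filter.Tendsto γ (𝓝[Ioo t (min u 1)] t) (𝓝[K] (γ t)) := by
      refine tendsto_nhdsWithin_iff.2 ⟨(hγc.tendsto t).mono_left nhdsWithin_le_nhds, ?_⟩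
      filter_upwards [self_mem_nhdsWithin] with v hv
      exact hγK v ⟨ht0.trans hv.1.le, hv.2.le.trans (min_le_right _ _)⟩
    have hlt : t < min u 1 := lt_min hu ht1
    have : (𝓝[Ioo t (min u 1)] t).NeBot := by
      apply mem_closure_iff_nhdsWithin_neBot.1
      rw [closure_Ioo hlt.ne]
      exact left_mem_Icc.2 hlt.le
    obtain ⟨v, hv, hvI⟩ := ((htend.eventually (h _ (hγK t ⟨ht0, ht1.le⟩))).and
      self_mem_nhdsWithin).exists
    refine ⟨v, ?_, hvI.1, hvI.2.le.trans (min_le_left _ _)⟩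
    have h2 := dist_triangle (φ (γ v)) (φ (γ t)) (φ x)
    rw [hv, hdist, abs_of_pos (sub_pos.2 hvI.1)] at h2
    have h3 : dist (φ (γ t)) (φ x) ≤ t * dist x y := hts
    change dist (φ (γ v)) (φ x) ≤ v * dist x y
    linarith
  have h2 : dist (φ (γ 1)) (φ x) ≤ 1 * dist x y := h1
  rw [dist_comm]
  simpa [hγ] using h2

lemma side_neg (d v : ℂ) : side (-d) v = -side d v := by simp [side_eq]; ring

lemma FoldedAt.creasePtOn {φ : ℂ → ℂ} {z d : ℂ} (h : FoldedAt φ z d) (K : Set ℂ) :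
    CreasePtOn K φ z := by
  obtain ⟨hd, f₁, f₂, hne, hf⟩ := h
  refine ⟨_, hf, d, hd, f₁, f₂, hne, fun y hy => hy.1.1.1 hy.2, fun y hy => hy.1.1.2 ?_⟩
  have : 0 ≤ side (-d) (y - z) := hy.2
  rw [side_neg] at this
  linarith

lemma IsOuterLocalFlatFolding.flatAt_or_foldedAt {K : Set ℂ} {φ : ℂ → ℂ}
    (h : IsOuterLocalFlatFolding K φ) {x : ℂ} (hx : x ∈ interior K) :
    FlatAt φ x ∨ ∃ d, FoldedAt φ x d := by
  have hK := mem_interior_iff_mem_nhds.1 hx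
  rcases h.classify x (interior_subset hx) with ⟨U, hU, f, hf⟩ |
    ⟨U, hU, d, hd, f₁, f₂, hne, h1, h2⟩ | hv
  · left
    refine ⟨f, ?_⟩
    filter_upwards [hU, hK] with y hyU hyK using hf ⟨hyU, hyK⟩
  · right
    refine ⟨d, hd, f₁, f₂, hne, ?_⟩
    filter_upwards [hU, hK] with y hyU hyK
    refine ⟨fun h0 => h1 ⟨⟨hyU, hyK⟩, h0⟩, fun h0 => h2 ⟨⟨hyU, hyK⟩, ?_⟩⟩
    change 0 ≤ side (-d) (y - x)
    rw [side_neg]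
    linarith
  · exact absurd hx (h.vertex_boundary x (interior_subset hx) hv).2

open Topology in
lemma IsOuterLocalFlatFolding.eventually_dist_eq {K : Set ℂ} {φ : ℂ → ℂ}
    (h : IsOuterLocalFlatFolding K φ) {x : ℂ} (hx : x ∈ K) :
    ∀ᶠ y in 𝓝[K] x, dist (φ y) (φ x) = dist y x := by
  rcases h.classify x hx with ⟨U, hU, f, hf⟩ | ⟨U, hU, d, hd, f₁, f₂, hne, h1, h2⟩ |
    ⟨U, hU, k, -, α, β, f, hαβ, hcov, hf, -⟩
  · filter_upwards [nhdsWithin_le_nhds hU, self_mem_nhdsWithin] with y hyU hyK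
    rw [hf ⟨hyU, hyK⟩, hf ⟨mem_of_mem_nhds hU, hx⟩, f.dist_eq]
  · have hxU := mem_of_mem_nhds hU
    filter_upwards [nhdsWithin_le_nhds hU, self_mem_nhdsWithin] with y hyU hyK
    have self : ∀ e, x ∈ closedHalfPlane x e := fun e => by simp [closedHalfPlane]
    rcases le_total 0 (side d (y - x)) with h0 | h0
    · rw [h1 ⟨⟨hyU, hyK⟩, h0⟩, h1 ⟨⟨hxU, hx⟩, self _⟩, f₁.dist_eq]
    · have h0' : y ∈ closedHalfPlane x (-d) := by
        change 0 ≤ side (-d) (y - x)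
        rw [side_neg]; linarith
      rw [h2 ⟨⟨hyU, hyK⟩, h0'⟩, h2 ⟨⟨hxU, hx⟩, self _⟩, f₂.dist_eq]
  · have hxU := mem_of_mem_nhds hU
    filter_upwards [nhdsWithin_le_nhds hU, self_mem_nhdsWithin] with y hyU hyK
    obtain ⟨i, hi⟩ := Set.mem_iUnion.1 (hcov ⟨hyU, hyK⟩)
    have hxi : x ∈ wedge x (α i) (β i) := ⟨0, le_rfl, α i, le_rfl, (hαβ i).le, by simp⟩
    rw [hf i ⟨⟨hyU, hyK⟩, hi⟩, hf i ⟨⟨hxU, hx⟩, hxi⟩, (f i).dist_eq]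

lemma lineFn_combo (n x y : ℂ) (d a b : ℝ) (hab : a + b = 1) :
    lineFn n d (a • x + b • y) = a * lineFn n d x + b * lineFn n d y := by
  simp [lineFn]
  linear_combination d * hab

/-- The chord of the disk cut out by a line. -/
def diskChord (c : ℂ) (ρ : ℝ) (n : ℂ) (δ : ℝ) : Set ℂ :=
  {x | x ∈ Metric.closedBall c ρ ∧ lineFn n δ (x - c) = 0}

lemma exists_isCreaseOf {φ : ℂ → ℂ} {c n : ℂ} {ρ δ : ℝ} (hn : ‖n‖ = 1) (h0 : 0 ≤ δ)
    (h1 : δ < ρ)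
    (h : ∀ x ∈ Metric.ball c ρ, lineFn n δ (x - c) = 0 → FoldedAt φ x (Complex.I * n)) :
    ∃ u v, IsCreaseOf (Metric.closedBall c ρ) φ u v ∧ diskChord c ρ n δ = segment ℝ u v := by
  have hn2 : n.re ^ 2 + n.im ^ 2 = 1 := by rw [← norm_sq_coord, hn]; norm_num
  have hρ : 0 < ρ := h0.trans_lt h1
  set k := √(ρ ^ 2 - δ ^ 2) with hk
  have hk0 : 0 < k := Real.sqrt_pos.2 (by nlinarith)
  have hk2 : k ^ 2 = ρ ^ 2 - δ ^ 2 := Real.sq_sqrt (by nlinarith)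
  have hend : ∀ τ : ℝ, τ ^ 2 = k ^ 2 → dist (c + n * ⟨δ, τ⟩) c = ρ ∧
      lineFn n δ (c + n * ⟨δ, τ⟩ - c) = 0 := by
    intro τ hτ
    rw [dist_eq_norm, add_sub_cancel_left, norm_mul, hn, one_mul]
    refine ⟨?_, ?_⟩
    · rw [← pow_left_inj₀ (norm_nonneg _) hρ.le two_ne_zero, norm_sq_coord]
      simp only
      linarith
    · simp [lineFn]; linear_combination δ * hn2
  obtain ⟨hu, hu0⟩ := hend k rfl
  obtain ⟨hv, hv0⟩ := hend (-k) (by ring)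
  have hsub : ∀ z x y : ℂ, ∀ a b : ℝ, a + b = 1 →
      a • x + b • y - z = a • (x - z) + b • (y - z) := by
    intro z x y a b hab
    have : (a : ℂ) + b = 1 := by exact_mod_cast hab
    simp only [Complex.real_smul]
    linear_combination z * (this)
  have hseg : diskChord c ρ n δ = segment ℝ (c + n * ⟨δ, k⟩) (c + n * ⟨δ, -k⟩) := by
    apply Set.Subset.antisymm
    · rintro x ⟨hx, hx0⟩
      rw [Metric.mem_closedBall, dist_eq_norm] at hx
      have hx2 := pow_le_pow_left₀ (norm_nonneg _) hx 2
      rw [norm_sq_coord] at hx2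
      simp only [lineFn] at hx0
      set τ := n.re * (x - c).im - n.im * (x - c).re with hτ
      have e1 : (x - c).re = n.re * δ - n.im * τ := by
        rw [hτ]; linear_combination n.re * hx0 - (x - c).re * hn2
      have e2 : (x - c).im = n.im * δ + n.re * τ := by
        rw [hτ]; linear_combination n.im * hx0 - (x - c).im * hn2
      have hτ2 : τ ^ 2 ≤ k ^ 2 := by
        have : (x - c).re ^ 2 + (x - c).im ^ 2 = δ ^ 2 + τ ^ 2 := by
          rw [e1, e2]; linear_combination (δ ^ 2 + τ ^ 2) * hn2
        linarith
      obtain ⟨t1, t2⟩ := abs_le.1 ((sq_le_sq₀ (abs_nonneg τ) hk0.le).1 (by rwa [sq_abs]))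
      refine ⟨(k + τ) / (2 * k), (k - τ) / (2 * k), div_nonneg (by linarith) (by linarith),
        div_nonneg (by linarith) (by linarith), by field_simp; ring, ?_⟩
      have hab : (k + τ) / (2 * k) + (k - τ) / (2 * k) = 1 := by field_simp; ring
      have hab' : ((k + τ) / (2 * k) - (k - τ) / (2 * k)) * k = τ := by field_simp; ring
      generalize (k + τ) / (2 * k) = a at *
      generalize (k - τ) / (2 * k) = b at *
      simp only [Complex.sub_re, Complex.sub_im] at e1 e2
      apply Complex.ext
      · simp
        linear_combination -e1 + (c.re + n.re * δ) * hab - n.im * hab'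
      · simp
        linear_combination -e2 + (c.im + n.im * δ) * hab + n.re * hab'
    · refine Convex.segment_subset ?_ ⟨hu.le, hu0⟩ ⟨hv.le, hv0⟩
      rintro x ⟨hx, hx0⟩ y ⟨hy, hy0⟩ a b ha hb hab
      refine ⟨convex_closedBall c ρ hx hy ha hb hab, ?_⟩
      rw [hsub c x y a b hab, lineFn_combo _ _ _ _ _ _ hab, hx0, hy0]; ring
  have hne : c + n * ⟨δ, k⟩ ≠ c + n * ⟨δ, -k⟩ := by
    intro he
    have hn0 : n ≠ 0 := by rintro rfl; simp at hn
    have := congrArg Complex.im (mul_left_cancel₀ hn0 (add_left_cancel he))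
    simp only at this
    linarith
  have hball := openSegment_subset_ball_of_ne (hu.le : _ ∈ Metric.closedBall c ρ) hv.le hne
  refine ⟨_, _, ⟨?_, ?_, hne, ?_, fun z hz => ?_⟩, hseg⟩
  · rw [frontier_closedBall c hρ.ne']; exact hu
  · rw [frontier_closedBall c hρ.ne']; exact hv
  · rwa [interior_closedBall c hρ.ne']
  · have : z ∈ diskChord c ρ n δ := hseg ▸ openSegment_subset_segment ℝ _ _ hz
    exact (h z (hball hz) this.2).creasePtOn _

lemma exists_chord_of_foldedAt {φ : ℂ → ℂ} {c z d : ℂ} {ρ : ℝ}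
    (h : ∀ x ∈ Metric.ball c ρ, FlatAt φ x ∨ ∃ d, FoldedAt φ x d) (hz : z ∈ Metric.ball c ρ)
    (hzd : FoldedAt φ z d) : ∃ (n : ℂ) (δ : ℝ), ‖n‖ = 1 ∧ 0 ≤ δ ∧ δ < ρ ∧
      lineFn n δ (z - c) = 0 ∧
      ∀ x ∈ Metric.ball c ρ, lineFn n δ (x - c) = 0 → FoldedAt φ x (Complex.I * n) := by
  obtain ⟨m, hm, hmd⟩ : ∃ m : ℂ, ‖m‖ = 1 ∧ side (Complex.I * m) d = 0 := by
    refine ⟨-Complex.I * ((‖d‖⁻¹ : ℝ) * d), ?_, ?_⟩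
    · rw [norm_mul, norm_mul, Complex.norm_real]
      simp [norm_ne_zero_iff.2 hzd.1]
    · simp [side_eq]; ring
  obtain ⟨n, hn, hnd, hpos⟩ : ∃ n : ℂ, ‖n‖ = 1 ∧ side (Complex.I * n) d = 0 ∧
      0 ≤ lineFn n 0 (z - c) := by
    rcases le_total 0 (lineFn m 0 (z - c)) with h0 | h0
    · exact ⟨m, hm, hmd, h0⟩
    · refine ⟨-m, by rwa [norm_neg], by rw [mul_neg, side_neg, hmd, neg_zero], ?_⟩
      simp only [lineFn, Complex.neg_re, Complex.neg_im] at h0 ⊢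
      linarith
  have hn2 : n.re ^ 2 + n.im ^ 2 = 1 := by rw [← norm_sq_coord, hn]; norm_num
  have hn0 : n ≠ 0 := by rintro rfl; simp at hn
  have hzn := hzd.congr (mul_ne_zero Complex.I_ne_zero hn0) hnd
  refine ⟨n, lineFn n 0 (z - c), hn, hpos, ?_, by simp [lineFn], fun x hx hx0 => ?_⟩
  · rw [Metric.mem_ball, dist_eq_norm] at hz
    refine lt_of_le_of_lt ?_ hz
    refine le_of_sq_le_sq ?_ (norm_nonneg _)
    rw [norm_sq_coord]
    simp only [lineFn, sub_zero]
    nlinarith [sq_nonneg (n.re * (z - c).im - n.im * (z - c).re)]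
  · refine hzn.of_side_eq_zero (convex_ball c ρ) h hz hx ?_
    simp [lineFn] at hx0
    simp [side_eq]
    linarith

/-- A folding of a disk with finitely many creases can be layered. -/
theorem exists_height_closedBall {φ : ℂ → ℂ} {c : ℂ} {ρ : ℝ} (hρ : 0 < ρ)
    (hφ : IsOuterLocalFlatFolding (Metric.closedBall c ρ) φ)
    (hfin : {s : Set ℂ | ∃ a b : ℂ, IsCreaseOf (Metric.closedBall c ρ) φ a b ∧
      s = segment ℝ a b}.Finite) :
    ∃ H : ℂ → ℝ, ContinuousOn H (Metric.closedBall c ρ) ∧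
      ∀ p ∈ Metric.closedBall c ρ, ∀ q ∈ Metric.closedBall c ρ, φ p = φ q → H p = H q → p = q := by
  have hlip : ∀ x ∈ Metric.closedBall c ρ, ∀ y ∈ Metric.closedBall c ρ,
      dist (φ x) (φ y) ≤ dist x y := fun x hx y hy =>
    dist_le_of_local hφ.convex (fun x hx => hφ.eventually_dist_eq hx) hx hy
  have hcases : ∀ x ∈ Metric.ball c ρ, FlatAt φ x ∨ ∃ d, FoldedAt φ x d := fun x hx =>
    hφ.flatAt_or_foldedAt (by rwa [interior_closedBall c hρ.ne'])
  set T : Set (Set ℂ) := {s | ∃ (n : ℂ) (δ : ℝ), ‖n‖ = 1 ∧ 0 ≤ δ ∧ δ < ρ ∧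
    (∀ x ∈ Metric.ball c ρ, lineFn n δ (x - c) = 0 → FoldedAt φ x (Complex.I * n)) ∧
    s = diskChord c ρ n δ} with hT
  have hTfin : T.Finite := hfin.subset fun s => by
    rintro ⟨n, δ, hn, h0, h1, h2, rfl⟩
    obtain ⟨u, v, huv, hs⟩ := exists_isCreaseOf hn h0 h1 h2
    exact ⟨u, v, huv, hs⟩
  have : Finite T := hTfin
  choose n δ hn h0 h1 hfold hs using fun s : T => s.2
  have scale : ∀ m k (x : ℂ), lineFn m k (c + ρ * x - c) = ρ * lineFn m (k / ρ) x := by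
    intro m k x
    simp [lineFn]; field_simp
  have hball : ∀ x : ℂ, ‖x‖ < 1 → c + ρ * x ∈ Metric.ball c ρ := fun x hx => by
    rw [Metric.mem_ball, dist_eq_norm, add_sub_cancel_left, norm_mul, Complex.norm_real,
      Real.norm_of_nonneg hρ.le]
    nlinarith
  have hcball : ∀ x : ℂ, ‖x‖ ≤ 1 → c + ρ * x ∈ Metric.closedBall c ρ := fun x hx => by
    rw [Metric.mem_closedBall, dist_eq_norm, add_sub_cancel_left, norm_mul, Complex.norm_real,
      Real.norm_of_nonneg hρ.le]
    nlinarith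
  let S : ChordSystem T :=
    { n := n
      d := fun s => δ s / ρ
      norm_n := hn
      d_nonneg := fun s => div_nonneg (h0 s) hρ.le
      d_lt_one := fun s => (div_lt_one hρ).2 (h1 s)
      noncross := by
        intro i j hij x hx hi hj
        have hi' : lineFn (n i) (δ i) (c + ρ * x - c) = 0 := by rw [scale, hi, mul_zero]
        have hj' : lineFn (n j) (δ j) (c + ρ * x - c) = 0 := by rw [scale, hj, mul_zero]
        have hpi := hfold i _ (hball x hx) hi'
        have hpj := hfold j _ (hball x hx) hj'
        obtain ⟨r, hr, he⟩ := exists_smul_of_side_eq_zero hpi.1 hpj.1 (hpi.parallel hpj)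
        have he' : n j = r * n i := by
          apply mul_left_cancel₀ Complex.I_ne_zero
          rw [he]; ring
        have hl : ∀ y, lineFn (n j) (δ j) y = r * lineFn (n i) (δ i) y := by
          intro y
          have hd : δ j = r * δ i := by
            rw [he'] at hj'
            simp only [lineFn] at hi' hj'
            simp at hi' hj'
            linear_combination r * hi' - hj'
          rw [he', hd]
          simp [lineFn]; ring
        refine hij (Subtype.ext ?_)
        rw [hs i, hs j]
        ext y
        simp [diskChord, hl, hr] }
  have hSℓ : ∀ s x, lineFn (n s) (δ s) (c + ρ * x - c) = ρ * S.ℓ s x := fun s x => scale _ _ _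
  set ψ : ℂ → ℂ := fun x => (ρ⁻¹ : ℝ) * φ (c + ρ * x) with hψ
  have hψd : ∀ x y, dist (ψ x) (ψ y) = ρ⁻¹ * dist (φ (c + ρ * x)) (φ (c + ρ * y)) := by
    intro x y
    rw [dist_eq_norm, dist_eq_norm, hψ, ← mul_sub, norm_mul, Complex.norm_real,
      Real.norm_of_nonneg (inv_nonneg.2 hρ.le)]
  have hd : ∀ x y : ℂ, dist x y = ρ⁻¹ * dist (c + ρ * x) (c + ρ * y) := by
    intro x y
    rw [dist_add_left, dist_eq_norm, dist_eq_norm, ← mul_sub, norm_mul, Complex.norm_real,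
      Real.norm_of_nonneg hρ.le]
    field_simp
  obtain ⟨H, hH, hinj⟩ := S.exists_height (φ := ψ)
    (fun x y hx hy => by
      rw [hψd, hd x y]
      exact mul_le_mul_of_nonneg_left (hlip _ (hcball x hx) _ (hcball y hy)) (inv_nonneg.2 hρ.le))
    (fun x y hx hy hxy => by
      rw [hψd, hd x y]
      congr 1
      refine dist_eq_of_flatAt (convex_segment (𝕜 := ℝ) _ _).isPreconnected (fun z hz => ?_)
        (left_mem_segment ℝ _ _) (right_mem_segment ℝ _ _)
      have hzb := (convex_ball c ρ).segment_subset (hball x hx) (hball y hy) hz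
      refine (hcases z hzb).resolve_right ?_
      rintro ⟨d, hzd⟩
      obtain ⟨m, k, hm, hk0, hk1, hzm, hmk⟩ := exists_chord_of_foldedAt hcases hzb hzd
      set s : T := ⟨diskChord c ρ m k, m, k, hm, hk0, hk1, hmk, rfl⟩
      have hzs : z ∈ diskChord c ρ (n s) (δ s) := by
        rw [← hs s]
        exact ⟨Metric.ball_subset_closedBall hzb, hzm⟩
      obtain ⟨a, b, ha, hb, hab, rfl⟩ := hz
      have hab' : (a : ℂ) + b = 1 := by exact_mod_cast hab
      have e : a • (c + ρ * x) + b • (c + ρ * y) = c + ρ * (a • x + b • y) := by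
        simp only [Complex.real_smul]
        linear_combination c * hab'
      have hz0 := hzs.2
      rw [e, hSℓ, ChordSystem.ℓ, lineFn_combo _ _ _ _ _ _ hab] at hz0
      have hz1 := (mul_eq_zero.1 hz0).resolve_left hρ.ne'
      change a * S.ℓ s x + b * S.ℓ s y = 0 at hz1
      rcases hxy s with ⟨hx', hy'⟩ | ⟨hx', hy'⟩
      · rcases ha.eq_or_lt with rfl | ha'
        · rw [show b = 1 by linarith] at hz1; linarith
        · nlinarith [mul_pos ha' hx', mul_nonneg hb hy'.le]
      · rcases ha.eq_or_lt with rfl | ha'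
        · rw [show b = 1 by linarith] at hz1; linarith
        · nlinarith [mul_neg_of_pos_of_neg ha' hx', mul_nonpos_of_nonneg_of_nonpos hb hy'.le])
  have hinv : ∀ p : ℂ, c + ρ * ((ρ⁻¹ : ℝ) * (p - c)) = p := fun p => by
    have : (ρ : ℂ) ≠ 0 := by exact_mod_cast hρ.ne'
    push_cast
    field_simp
    ring
  have hmaps : ∀ p ∈ Metric.closedBall c ρ, ‖(ρ⁻¹ : ℝ) * (p - c)‖ ≤ 1 := fun p hp => by
    rw [Metric.mem_closedBall, dist_eq_norm] at hp
    rw [norm_mul, Complex.norm_real, Real.norm_of_nonneg (inv_nonneg.2 hρ.le), inv_mul_le_one₀ hρ]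
    exact hp
  refine ⟨fun p => H ((ρ⁻¹ : ℝ) * (p - c)), hH.comp (by fun_prop) fun p hp =>
    mem_closedBall_zero_iff.2 (hmaps p hp), fun p hp q hq hpq hHpq => ?_⟩
  have := hinj _ _ (hmaps p hp) (hmaps q hq) (by simp only [hψ, hinv, hpq]) hHpq
  rw [← hinv p, this, hinv]

theorem stmt14_disk_local_global (K : Set ℂ) (φ : ℂ → ℂ)
    (hdisk : ∃ (c : ℂ) (ρ : ℝ), 0 < ρ ∧ K = Metric.closedBall c ρ)
    (hφ : IsOuterLocalFlatFolding K φ)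
    (hfin : {s : Set ℂ | ∃ a b : ℂ, IsCreaseOf K φ a b ∧ s = segment ℝ a b}.Finite) :
    IsOuterGlobalFlatFolding K φ := by
  refine ⟨hφ, fun ε hε => ?_⟩
  obtain ⟨c, ρ, hρ, rfl⟩ := hdisk
  obtain ⟨H, hH, hinj⟩ := exists_height_closedBall hρ hφ hfin
  refine ⟨fun p => !₂[(φ p).re, (φ p).im, H p], ?_, fun p _ => ?_⟩
  · have : CompactSpace (Metric.closedBall c ρ) := isCompact_iff_compactSpace.1 hφ.compact
    have h1 := continuousOn_iff_continuous_domRestrict.1 hφ.continuousOn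
    have h2 := continuousOn_iff_continuous_domRestrict.1 hH
    refine (Continuous.isClosedEmbedding ?_ ?_).isEmbedding
    · refine (PiLp.continuous_toLp 2 _).comp (continuous_pi fun i => ?_)
      fin_cases i
      · exact Complex.continuous_re.comp h1
      · exact Complex.continuous_im.comp h1
      · exact h2
    · intro p q hpq
      have e0 := congrArg (fun v : Space3 => v 0) hpq
      have e1 := congrArg (fun v : Space3 => v 1) hpq
      have e2 := congrArg (fun v : Space3 => v 2) hpq
      exact Subtype.ext (hinj p p.2 q q.2 (Complex.ext e0 e1) e2)
  · have : proj2 !₂[(φ p).re, (φ p).im, H p] = φ p := by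
      apply Complex.ext <;> simp [proj2]
    rw [this, dist_self]
    exact hε.le
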